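/- Let A be a symmetric convex body in ℝⁿ, let ‖·‖_A be its gauge and X = (ℝⁿ, ‖·‖_A), and let 1 ≤ s ≤ n−1. There exist absolute constants C, c > 0 such that ν_{n,s}({F ∈ G_{n,s} : |M_F(A) − M(A)| > ε·M(A)}) ≤ C·exp(−c·s·ε²·k(X)) for all ε > 0, where M_F(A) = ∫_{S_F} ‖θ‖_A dσ_F(θ) and M(A) = ∫_{S^{n−1}} ‖θ‖_A dσ(θ). -/

import Mathlib

open MeasureTheory ProbabilityTheory Real Set
open scoped Matrix

/-- The rotation-invariant (uniform) probability measure `σ` on the Euclidean unit sphere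
`S^{n−1}`, viewed as a measure on `ℝⁿ` supported on the sphere. -/
noncomputable def uniformSphere (n : ℕ) : Measure (EuclideanSpace ℝ (Fin n)) :=
  (((volume : Measure (EuclideanSpace ℝ (Fin n))).toSphere Set.univ)⁻¹ •
    (volume : Measure (EuclideanSpace ℝ (Fin n))).toSphere).map Subtype.val

/-- The average of a function `f` over the unit sphere `S_F` of a subspace `F ⊆ ℝⁿ`,
with respect to the rotation-invariant probability measure `σ_F` on `S_F`; it is computed
by transporting the uniform sphere measure through a linear isometry
`ℝ^{dim F} ≃ F` coming from an orthonormal basis of `F` (by rotation invariance this does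
not depend on the choice of the isometry). -/
noncomputable def subsphereAvg {n : ℕ} (F : Submodule ℝ (EuclideanSpace ℝ (Fin n)))
    (f : EuclideanSpace ℝ (Fin n) → ℝ) : ℝ :=
  ∫ θ, f (((stdOrthonormalBasis ℝ F).repr.symm θ : F) : EuclideanSpace ℝ (Fin n))
    ∂uniformSphere (Module.finrank ℝ F)

/-- `M(A) = ∫_{S^{n−1}} ‖θ‖_A dσ(θ)` where `‖·‖_A` is the gauge of `A`. -/
noncomputable def sphereMeanGauge {n : ℕ} (A : Set (EuclideanSpace ℝ (Fin n))) : ℝ :=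
  ∫ θ, gauge A θ ∂uniformSphere n

/-- `b(X) = max_{θ ∈ S^{n−1}} ‖θ‖_A`. -/
noncomputable def sphereMaxGauge {n : ℕ} (A : Set (EuclideanSpace ℝ (Fin n))) : ℝ :=
  sSup {r : ℝ | ∃ θ : EuclideanSpace ℝ (Fin n), ‖θ‖ = 1 ∧ r = gauge A θ}

/-- The Dvoretzky number `k(X) = n (M/b)²` of `X = (ℝⁿ, ‖·‖_A)`. -/
noncomputable def dvoretzkyDim {n : ℕ} (A : Set (EuclideanSpace ℝ (Fin n))) : ℝ :=
  n * (sphereMeanGauge A / sphereMaxGauge A) ^ 2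

/-- `ν` is the Haar probability measure `ν_{n,s}` on the Grassmannian `G_{n,s}`, encoded as
a measure on `n × n` matrices supported on orthogonal projections of rank `s` and invariant
under conjugation by the orthogonal group `O(n)` (such an invariant probability measure is
unique, namely the pushforward of Haar measure on `O(n)` under `U ↦ U E₀ U*`). -/
def IsHaarGrassmannian (n s : ℕ) (ν : Measure (Fin n → Fin n → ℝ)) : Prop :=
  IsProbabilityMeasure ν ∧
  (∀ᵐ P ∂ν, Matrix.of P * Matrix.of P = Matrix.of P ∧ (Matrix.of P)ᵀ = Matrix.of P ∧
    (Matrix.of P).rank = s) ∧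
  ∀ U : Matrix (Fin n) (Fin n) ℝ, U ∈ Matrix.orthogonalGroup (Fin n) ℝ →
    ν.map (fun P => Matrix.of.symm (U * Matrix.of P * Uᵀ)) = ν

section Helpers

open scoped NNReal ENNReal Topology Convolution

/-- Jensen for the exponential, in extended form. -/
lemma jexp {α : Type*} [MeasurableSpace α] {μ : Measure α} [IsProbabilityMeasure μ] {f : α → ℝ}
    (hf : Integrable f μ) :
    ENNReal.ofReal (exp (∫ x, f x ∂μ)) ≤ ∫⁻ x, ENNReal.ofReal (exp (f x)) ∂μ := by
  by_cases h : ∫⁻ x, ENNReal.ofReal (exp (f x)) ∂μ = ∞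
  · rw [h]; exact le_top
  have hm : AEStronglyMeasurable (fun x => exp (f x)) μ :=
    continuous_exp.comp_aestronglyMeasurable hf.1
  have hi : Integrable (fun x => exp (f x)) μ := by
    refine ⟨hm, ?_⟩
    rw [hasFiniteIntegral_iff_ofReal (Filter.Eventually.of_forall fun x => (exp_pos _).le)]
    exact lt_top_iff_ne_top.2 h
  rw [← ofReal_integral_eq_lintegral_ofReal hi (Filter.Eventually.of_forall fun x => (exp_pos _).le)]
  exact ENNReal.ofReal_le_ofReal (convexOn_exp.map_integral_le continuous_exp.continuousOn
    isClosed_univ (by simp) hf hi)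

section Gauss
variable {E : Type*} [NormedAddCommGroup E] [InnerProductSpace ℝ E] [FiniteDimensional ℝ E]
  [MeasurableSpace E] [BorelSpace E]

lemma lip_integrable {L : ℝ≥0} {ψ : E → ℝ} (hψ : LipschitzWith L ψ) :
    Integrable ψ (stdGaussian E) := by
  have h1 : Integrable (fun x : E => ‖ψ 0‖ + L * ‖x‖) (stdGaussian E) :=
    (integrable_const _).add ((IsGaussian.integrable_id (μ := stdGaussian E)).norm.const_mul _)
  refine h1.mono' hψ.continuous.aestronglyMeasurable (Filter.Eventually.of_forall fun x => ?_)
  have := hψ.dist_le_mul x 0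
  rw [dist_eq_norm, dist_zero_right] at this
  calc ‖ψ x‖ = ‖ψ 0 + (ψ x - ψ 0)‖ := by congr 1; ring
    _ ≤ ‖ψ 0‖ + ‖ψ x - ψ 0‖ := norm_add_le _ _
    _ ≤ _ := by gcongr

lemma lint_exp_dual (l : StrongDual ℝ E) :
    ∫⁻ y, ENNReal.ofReal (exp (l y)) ∂(stdGaussian E) = ENNReal.ofReal (exp (‖l‖ ^ 2 / 2)) := by
  have h := IsGaussian.map_eq_gaussianReal (μ := stdGaussian E) l
  rw [integral_strongDual_stdGaussian, variance_dual_stdGaussian] at h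
  have hm := mgf_gaussianReal h 1
  have hi : Integrable (fun y => exp (l y)) (stdGaussian E) := by
    have := integrable_exp_mul_gaussianReal (μ := 0) (v := (‖l‖ ^ 2).toNNReal) 1
    rw [← h, integrable_map_measure (by fun_prop) (by fun_prop)] at this
    simpa [Function.comp_def] using this
  rw [← ofReal_integral_eq_lintegral_ofReal hi (Filter.Eventually.of_forall fun x => (exp_pos _).le)]
  congr 1
  simp only [mgf, one_mul] at hm
  rw [hm]
  simp

lemma rot_hasDerivAt (x y : E) (θ : ℝ) :
    HasDerivAt (fun θ => (ContinuousLinearMap.rotation θ (y, x)).1)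
      (ContinuousLinearMap.rotation θ (y, x)).2 θ := by
  have h := ((hasDerivAt_cos θ).smul_const y).add ((hasDerivAt_sin θ).smul_const x)
  simp only [ContinuousLinearMap.rotation_apply]
  exact h

set_option maxHeartbeats 1000000 in
/-- Maurey–Pisier for `C¹` Lipschitz functions. -/
lemma maurey_pisier_C1 {L : ℝ≥0} {ψ : E → ℝ} (hψ : LipschitzWith L ψ) (hc : ContDiff ℝ 1 ψ) :
    ∫⁻ x, ENNReal.ofReal (exp (ψ x - ∫ y, ψ y ∂(stdGaussian E))) ∂(stdGaussian E)
      ≤ ENNReal.ofReal (exp (π ^ 2 / 8 * L ^ 2)) := by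
  set γ := stdGaussian E with hγ
  have hIntg := lip_integrable hψ
  have hfc : Continuous (fderiv ℝ ψ) := hc.continuous_fderiv (by norm_num)
  have hpi : 0 < π / 2 := by positivity
  let ρ : Measure ℝ := (ENNReal.ofReal (π / 2))⁻¹ • volume.restrict (Ioc 0 (π / 2))
  have hρ : IsProbabilityMeasure ρ := ⟨by
    simp only [ρ, Measure.smul_apply, Measure.restrict_apply_univ, Real.volume_Ioc, sub_zero,
      smul_eq_mul]
    exact ENNReal.inv_mul_cancel (by simpa using hpi) ENNReal.ofReal_ne_top⟩
  obtain ⟨R, hRd⟩ : ∃ R : ℝ → E × E → E × E, ∀ θ p, R θ p = ContinuousLinearMap.rotation θ p :=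
    ⟨_, fun _ _ => rfl⟩
  have hR : Continuous (fun q : ℝ × (E × E) => R q.1 q.2) := by
    simp only [hRd, ContinuousLinearMap.rotation_apply]
    fun_prop
  have hR2 : ∀ p, Continuous (fun θ => R θ p) := by
    intro p
    simp only [hRd, ContinuousLinearMap.rotation_apply]
    fun_prop
  obtain ⟨D, hDd⟩ : ∃ D : E × E → ℝ, ∀ p, D p = (π / 2) * fderiv ℝ ψ p.1 p.2 :=
    ⟨_, fun _ => rfl⟩
  have hD : Continuous D := by
    have : Continuous (fun p : E × E => fderiv ℝ ψ p.1 p.2) :=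
      (hfc.comp continuous_fst).clm_apply continuous_snd
    rw [funext hDd]
    exact continuous_const.mul this
  -- path formula
  have hpath : ∀ x y : E, ψ x - ψ y = ∫ θ, D (R θ (y, x)) ∂ρ := by
    intro x y
    have hd : ∀ θ ∈ uIcc (0 : ℝ) (π / 2), HasDerivAt (fun θ => ψ (R θ (y, x)).1)
        (fderiv ℝ ψ (R θ (y, x)).1 (R θ (y, x)).2) θ := by
      intro θ _
      have h1 : HasDerivAt (fun θ => (R θ (y, x)).1) (R θ (y, x)).2 θ := by
        simp only [hRd]
        exact rot_hasDerivAt x y θ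
      have h2 : HasFDerivAt ψ (fderiv ℝ ψ (R θ (y, x)).1) (R θ (y, x)).1 :=
        ((hc.differentiable (by norm_num)) _).hasFDerivAt
      exact h2.comp_hasDerivAt θ h1
    have hcont : Continuous (fun θ => fderiv ℝ ψ (R θ (y, x)).1 (R θ (y, x)).2) := by
      have h2 : Continuous (fun θ => R θ (y, x)) := hR2 _
      exact (hfc.comp (continuous_fst.comp h2)).clm_apply (continuous_snd.comp h2)
    have := intervalIntegral.integral_eq_sub_of_hasDerivAt hd (hcont.intervalIntegrable _ _)
    simp only [hRd, ContinuousLinearMap.rotation_apply, cos_pi_div_two, sin_pi_div_two, cos_zero,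
      sin_zero, zero_smul, one_smul, zero_add, add_zero] at this
    rw [← this, intervalIntegral.integral_of_le hpi.le]
    simp only [hDd, ρ, integral_smul_measure, integral_const_mul, ENNReal.toReal_inv,
      ENNReal.toReal_ofReal hpi.le, smul_eq_mul, hRd, ContinuousLinearMap.rotation_apply]
    field_simp
  have hDi : ∀ x y : E, Integrable (fun θ => D (R θ (y, x))) ρ := by
    intro x y
    have h2 : Continuous (fun θ => D (R θ (y, x))) :=
      hD.comp (hR2 _)
    have h3 : IntegrableOn (fun θ => D (R θ (y, x))) (Ioc 0 (π / 2)) volume :=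
      (h2.integrableOn_Icc).mono_set Ioc_subset_Icc_self
    exact h3.smul_measure (by simpa using hpi)
  have hmeas : Measurable (fun p : E × E => ENNReal.ofReal (exp (D p))) := by
    have := hD.measurable
    fun_prop
  calc ∫⁻ x, ENNReal.ofReal (exp (ψ x - ∫ y, ψ y ∂γ)) ∂γ
      = ∫⁻ x, ENNReal.ofReal (exp (∫ y, (ψ x - ψ y) ∂γ)) ∂γ := by
        refine lintegral_congr fun x => ?_
        rw [integral_sub (integrable_const _) hIntg]; simp [hγ]
    _ ≤ ∫⁻ x, ∫⁻ y, ENNReal.ofReal (exp (ψ x - ψ y)) ∂γ ∂γ :=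
        lintegral_mono fun x => jexp ((integrable_const _).sub hIntg)
    _ ≤ ∫⁻ x, ∫⁻ y, ∫⁻ θ, ENNReal.ofReal (exp (D (R θ (y, x)))) ∂ρ ∂γ ∂γ := by
        refine lintegral_mono fun x => lintegral_mono fun y => ?_
        simp only
        rw [hpath x y]
        exact jexp (hDi x y)
    _ = ∫⁻ y, ∫⁻ x, ∫⁻ θ, ENNReal.ofReal (exp (D (R θ (y, x)))) ∂ρ ∂γ ∂γ := by
        rw [lintegral_lintegral_swap]
        apply Measurable.aemeasurable
        apply Measurable.lintegral_prod_right' (f := fun q : (E × E) × ℝ =>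
          ENNReal.ofReal (exp (D (R q.2 (q.1.2, q.1.1)))))
        apply hmeas.comp
        exact (hR.comp (by fun_prop : Continuous (fun q : (E × E) × ℝ =>
          ((q.2, (q.1.2, q.1.1)) : ℝ × E × E)))).measurable
    _ = ∫⁻ p, ∫⁻ θ, ENNReal.ofReal (exp (D (R θ p))) ∂ρ ∂(γ.prod γ) := by
        rw [lintegral_prod]
        apply Measurable.aemeasurable
        apply Measurable.lintegral_prod_right' (f := fun q : (E × E) × ℝ =>
          ENNReal.ofReal (exp (D (R q.2 q.1))))
        apply hmeas.comp
        exact (hR.comp (by fun_prop : Continuous (fun q : (E × E) × ℝ =>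
          ((q.2, q.1) : ℝ × E × E)))).measurable
    _ = ∫⁻ θ, ∫⁻ p, ENNReal.ofReal (exp (D (R θ p))) ∂(γ.prod γ) ∂ρ := by
        rw [lintegral_lintegral_swap]
        apply Measurable.aemeasurable
        apply hmeas.comp
        exact (hR.comp (by fun_prop : Continuous (fun q : (E × E) × ℝ =>
          ((q.2, q.1) : ℝ × E × E)))).measurable
    _ = ∫⁻ θ, ∫⁻ p, ENNReal.ofReal (exp (D p)) ∂(γ.prod γ) ∂ρ := by
        refine lintegral_congr fun θ => ?_
        conv_rhs => rw [← IsGaussian.map_rotation_eq_self (μ := γ)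
          (by simp [hγ, integral_id_stdGaussian]) θ]
        rw [lintegral_map hmeas (by fun_prop)]
        simp only [hRd]
    _ = ∫⁻ p, ENNReal.ofReal (exp (D p)) ∂(γ.prod γ) := by simp
    _ = ∫⁻ x, ∫⁻ y, ENNReal.ofReal (exp (D (x, y))) ∂γ ∂γ := by
        rw [lintegral_prod _ hmeas.aemeasurable]
    _ ≤ ∫⁻ x, ENNReal.ofReal (exp (π ^ 2 / 8 * L ^ 2)) ∂γ := by
        refine lintegral_mono fun x => ?_
        have := lint_exp_dual ((π / 2) • fderiv ℝ ψ x)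
        simp only [FunLike.coe_smul, Pi.smul_apply, smul_eq_mul] at this
        simp only [hDd, hγ]
        rw [this]
        apply ENNReal.ofReal_le_ofReal
        rw [exp_le_exp, norm_smul, mul_pow, Real.norm_of_nonneg hpi.le]
        have h1 : ‖fderiv ℝ ψ x‖ ≤ L := norm_fderiv_le_of_lipschitz ℝ hψ
        have h2 : ‖fderiv ℝ ψ x‖ ^ 2 ≤ L ^ 2 := by gcongr
        nlinarith [sq_nonneg π]
    _ = _ := by simp

lemma exists_mollify {L : ℝ≥0} {ψ : E → ℝ} (hψ : LipschitzWith L ψ) {δ : ℝ} (hδ : 0 < δ) :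
    ∃ φ : E → ℝ, LipschitzWith L φ ∧ ContDiff ℝ 1 φ ∧ ∀ x, |φ x - ψ x| ≤ δ := by
  obtain ⟨r, hr, hrL⟩ : ∃ r : ℝ, 0 < r ∧ L * r ≤ δ := by
    refine ⟨δ / (L + 1), by positivity, ?_⟩
    rw [mul_div_assoc', div_le_iff₀ (by positivity)]
    nlinarith [L.2]
  let B : ContDiffBump (0 : E) := ⟨r / 2, r, by positivity, by linarith⟩
  let μ : Measure E := volume
  have hcs : HasCompactSupport (B.normed μ) := B.hasCompactSupport_normed
  have hcd : ContDiff ℝ 1 (B.normed μ) := B.contDiff_normed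
  have hce : ConvolutionExists (B.normed μ) ψ (ContinuousLinearMap.lsmul ℝ ℝ) μ :=
    hcs.convolutionExists_left _ hcd.continuous hψ.continuous.locallyIntegrable
  refine ⟨B.normed μ ⋆[ContinuousLinearMap.lsmul ℝ ℝ, μ] ψ, ?_, ?_, ?_⟩
  · refine LipschitzWith.of_dist_le_mul fun x y => ?_
    rw [dist_eq_norm, convolution_def, convolution_def, ← integral_sub (hce x) (hce y)]
    calc _ ≤ ∫ z, B.normed μ z * (L * dist x y) ∂μ := by
          apply norm_integral_le_of_norm_le
          · exact B.integrable_normed.mul_const _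
          · refine Filter.Eventually.of_forall fun z => ?_
            simp only [ContinuousLinearMap.lsmul_apply, smul_eq_mul]
            rw [← mul_sub, norm_mul, Real.norm_of_nonneg (B.nonneg_normed z)]
            refine mul_le_mul_of_nonneg_left ?_ (B.nonneg_normed z)
            have := hψ.dist_le_mul (x - z) (y - z)
            rwa [dist_sub_right, dist_eq_norm] at this
      _ = _ := by rw [integral_mul_const, B.integral_normed, one_mul]
  · exact hcs.contDiff_convolution_left _ hcd hψ.continuous.locallyIntegrable
  · intro x
    rw [← Real.dist_eq]
    refine B.dist_normed_convolution_le hψ.continuous.aestronglyMeasurable fun z hz => ?_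
    refine (hψ.dist_le_mul z x).trans (le_trans ?_ hrL)
    have : dist z x ≤ r := (Metric.mem_ball.1 hz).le
    gcongr

/-- Gaussian concentration (Maurey–Pisier) for Lipschitz functions. -/
theorem gauss_conc {L : ℝ≥0} {ψ : E → ℝ} (hψ : LipschitzWith L ψ) :
    ∫⁻ x, ENNReal.ofReal (exp (ψ x - ∫ y, ψ y ∂(stdGaussian E))) ∂(stdGaussian E)
      ≤ ENNReal.ofReal (exp (π ^ 2 / 8 * L ^ 2)) := by
  have key : ∀ δ > 0, ∫⁻ x, ENNReal.ofReal (exp (ψ x - ∫ y, ψ y ∂(stdGaussian E))) ∂(stdGaussian E)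
      ≤ ENNReal.ofReal (exp (2 * δ + π ^ 2 / 8 * L ^ 2)) := by
    intro δ hδ
    obtain ⟨φ, h1, h2, h3⟩ := exists_mollify hψ hδ
    have hi : ∫ y, φ y ∂(stdGaussian E) ≤ ∫ y, ψ y ∂(stdGaussian E) + δ := by
      have : ∫ y, φ y ∂(stdGaussian E) ≤ ∫ y, (ψ y + δ) ∂(stdGaussian E) :=
        integral_mono (lip_integrable h1) ((lip_integrable hψ).add (integrable_const _))
          fun x => by have := abs_le.1 (h3 x); simp only; linarith
      rw [integral_add (lip_integrable hψ) (integrable_const _)] at this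
      simpa using this
    calc _ ≤ ∫⁻ x, ENNReal.ofReal (exp (2 * δ)) *
          ENNReal.ofReal (exp (φ x - ∫ y, φ y ∂(stdGaussian E))) ∂(stdGaussian E) := by
          refine lintegral_mono fun x => ?_
          simp only
          rw [← ENNReal.ofReal_mul (exp_pos _).le, ← exp_add]
          apply ENNReal.ofReal_le_ofReal
          rw [exp_le_exp]
          have := abs_le.1 (h3 x)
          linarith
      _ = ENNReal.ofReal (exp (2 * δ)) * ∫⁻ x,
          ENNReal.ofReal (exp (φ x - ∫ y, φ y ∂(stdGaussian E))) ∂(stdGaussian E) :=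
          lintegral_const_mul' _ _ ENNReal.ofReal_ne_top
      _ ≤ ENNReal.ofReal (exp (2 * δ)) * ENNReal.ofReal (exp (π ^ 2 / 8 * L ^ 2)) := by
          gcongr
          exact maurey_pisier_C1 h1 h2
      _ = _ := by rw [← ENNReal.ofReal_mul (exp_pos _).le, ← exp_add]
  have ht : Filter.Tendsto (fun δ : ℝ => ENNReal.ofReal (exp (2 * δ + π ^ 2 / 8 * L ^ 2)))
      (𝓝[>] 0) (𝓝 (ENNReal.ofReal (exp (2 * 0 + π ^ 2 / 8 * L ^ 2)))) := by
    apply Filter.Tendsto.mono_left _ nhdsWithin_le_nhds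
    apply Continuous.tendsto (f := fun δ : ℝ => ENNReal.ofReal (exp (2 * δ + π ^ 2 / 8 * L ^ 2)))
    exact ENNReal.continuous_ofReal.comp (by fun_prop)
  rw [mul_zero, zero_add] at ht
  exact ge_of_tendsto ht (Filter.eventually_of_mem self_mem_nhdsWithin key)

end Gauss

/-- Euclidean space. -/
noncomputable abbrev EE (n : ℕ) := EuclideanSpace ℝ (Fin n)
/-- The orthogonal group. -/
noncomputable abbrev OG (n : ℕ) := unitary (EE n →L[ℝ] EE n)

instance contStarEE (n : ℕ) : ContinuousStar (EE n →L[ℝ] EE n) :=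
  ⟨(ContinuousLinearMap.adjoint (𝕜 := ℝ) (E := EE n) (F := EE n)).continuous⟩

lemma og_norm {n : ℕ} (U : OG n) (x : EE n) : ‖(U : EE n →L[ℝ] EE n) x‖ = ‖x‖ :=
  (Unitary.linearIsometryEquiv U).norm_map x

instance compactOG (n : ℕ) : CompactSpace (OG n) := by
  refine isCompact_iff_compactSpace.1 ?_
  refine Metric.isCompact_of_isClosed_isBounded (isClosed_unitary (R := EE n →L[ℝ] EE n)) ?_
  refine (Metric.isBounded_closedBall (x := (0 : EE n →L[ℝ] EE n)) (r := 1)).subset fun U hU => ?_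
  rw [mem_closedBall_zero_iff]
  refine ContinuousLinearMap.opNorm_le_bound _ zero_le_one fun x => ?_
  rw [one_mul]
  exact (og_norm ⟨U, hU⟩ x).le

/-- Haar probability measure on the orthogonal group. -/
noncomputable def hO (n : ℕ) : Measure (OG n) := Measure.haarMeasure ⊤

instance hO_prob (n : ℕ) : IsProbabilityMeasure (hO n) := ⟨by
  have := Measure.haarMeasure_self (G := OG n) (K₀ := ⊤)
  simpa [hO] using this⟩

instance hO_left (n : ℕ) : (hO n).IsMulLeftInvariant := by
  unfold hO; infer_instance

lemma og_inv_mul_apply {n : ℕ} (W U : OG n) (x : EE n) :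
    (((W * U)⁻¹ : OG n) : EE n →L[ℝ] EE n) ((W : EE n →L[ℝ] EE n) x)
      = ((U⁻¹ : OG n) : EE n →L[ℝ] EE n) x := by
  have : ((W * U)⁻¹ * W : OG n) = U⁻¹ := by group
  rw [← this]; rfl

lemma og_inv_apply {n : ℕ} (W : OG n) (x : EE n) :
    ((W⁻¹ : OG n) : EE n →L[ℝ] EE n) ((W : EE n →L[ℝ] EE n) x) = x := by
  have := og_inv_mul_apply W 1 x
  simpa using this

lemma og_apply_inv {n : ℕ} (W : OG n) (x : EE n) :
    (W : EE n →L[ℝ] EE n) (((W⁻¹ : OG n) : EE n →L[ℝ] EE n) x) = x := by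
  have := og_inv_apply W⁻¹ x
  simpa using this

lemma og_inner {n : ℕ} (W : OG n) (x y : EE n) :
    inner ℝ ((W : EE n →L[ℝ] EE n) x) ((W : EE n →L[ℝ] EE n) y) = inner ℝ x y :=
  (Unitary.linearIsometryEquiv W).inner_map_map x y

/-- An isometry of the space comes from the group. -/
lemma og_of_isometry {n : ℕ} (L : EE n →ₗᵢ[ℝ] EE n) :
    ∃ W : OG n, ∀ x, (W : EE n →L[ℝ] EE n) x = L x := by
  refine ⟨Unitary.linearIsometryEquiv.symm (L.toLinearIsometryEquiv rfl), fun x => ?_⟩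
  rfl

lemma orth_ext {s n : ℕ} (ι κ : EE s →ₗᵢ[ℝ] EE n) :
    ∃ W : OG n, ∀ x, (W : EE n →L[ℝ] EE n) (ι x) = κ x := by
  let e := ι.equivRange
  obtain ⟨W, hW⟩ := og_of_isometry ((κ.comp e.symm.toLinearIsometry).extend)
  refine ⟨W, fun x => ?_⟩
  have h1 : ι x = ((e x : LinearMap.range ι.toLinearMap) : EE n) := rfl
  rw [hW, h1, LinearIsometry.extend_apply]
  simp

lemma orth_trans {n : ℕ} {x y : EE n} (h : ‖x‖ = ‖y‖) :
    ∃ W : OG n, (W : EE n →L[ℝ] EE n) x = y := by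
  obtain ⟨W, hW⟩ := og_of_isometry ((ℝ ∙ (x - y))ᗮ.reflection).toLinearIsometry
  exact ⟨W, by rw [hW]; exact Submodule.reflection_sub h⟩

section Sphere

lemma uniformSphere_apply {n : ℕ} {S : Set (EE n)} (hS : MeasurableSet S) :
    uniformSphere n S = ((volume : Measure (EE n)).toSphere univ)⁻¹ *
      (n * volume {x : EE n | x ≠ 0 ∧ ‖x‖ < 1 ∧ ‖x‖⁻¹ • x ∈ S}) := by
  have hm : MeasurableSet ((↑) ⁻¹' S : Set (Metric.sphere (0 : EE n) 1)) :=
    measurable_subtype_coe hS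
  rw [uniformSphere, Measure.map_apply measurable_subtype_coe hS, Measure.smul_apply,
    Measure.toSphere_apply' _ hm, smul_eq_mul, finrank_euclideanSpace_fin]
  congr 3
  ext x
  simp only [mem_ofPred_eq, mem_smul, mem_image, mem_preimage, Subtype.exists, exists_and_right,
    exists_eq_right, mem_sphere_iff_norm, sub_zero, exists_prop]
  constructor
  · rintro ⟨r, hr, y, ⟨h1, h2⟩, rfl⟩
    have h1' : ‖y‖ = 1 := h1
    have hn : ‖r • y‖ = r := by rw [norm_smul, h1', mul_one, Real.norm_of_nonneg hr.1.le]
    refine ⟨?_, by rw [hn]; exact hr.2, ?_⟩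
    · rw [← norm_ne_zero_iff, hn]; exact hr.1.ne'
    · rw [hn, smul_smul, inv_mul_cancel₀ hr.1.ne', one_smul]; exact h2
  · rintro ⟨h0, h1, h2⟩
    have h0' := norm_pos_iff.2 h0
    refine ⟨‖x‖, ⟨h0', h1⟩, ‖x‖⁻¹ • x, ⟨?_, h2⟩, ?_⟩
    · rw [norm_smul, norm_inv, norm_norm, inv_mul_cancel₀ h0'.ne']
    · rw [smul_smul, mul_inv_cancel₀ h0'.ne', one_smul]

lemma uniformSphere_prob {n : ℕ} (hn : 1 ≤ n) : IsProbabilityMeasure (uniformSphere n) := by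
  have : Nonempty (Fin n) := ⟨⟨0, hn⟩⟩
  refine ⟨?_⟩
  rw [uniformSphere, Measure.map_apply measurable_subtype_coe .univ, preimage_univ,
    Measure.smul_apply, smul_eq_mul]
  refine ENNReal.inv_mul_cancel ?_ (measure_ne_top _ _)
  rw [Ne, Measure.measure_univ_eq_zero]
  exact Measure.toSphere_ne_zero _

lemma uniformSphere_norm (n : ℕ) : ∀ᵐ x ∂(uniformSphere n), ‖x‖ = 1 := by
  rw [uniformSphere, ae_map_iff (by fun_prop)
    (measurableSet_eq_fun (by fun_prop) (by fun_prop))]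
  refine Filter.Eventually.of_forall fun x => ?_
  exact mem_sphere_zero_iff_norm.1 x.2

lemma uniformSphere_map {n : ℕ} (W : OG n) :
    (uniformSphere n).map (W : EE n →L[ℝ] EE n) = uniformSphere n := by
  ext S hS
  have hc : Measurable (W : EE n →L[ℝ] EE n) := (W : EE n →L[ℝ] EE n).continuous.measurable
  rw [Measure.map_apply hc hS, uniformSphere_apply (hc hS), uniformSphere_apply hS]
  congr 2
  have hmp := (Unitary.linearIsometryEquiv W).measurePreserving
  have hms : MeasurableSet {x : EE n | x ≠ 0 ∧ ‖x‖ < 1 ∧ ‖x‖⁻¹ • x ∈ S} := by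
    refine (measurableSet_singleton (0 : EE n)).compl.inter (MeasurableSet.inter
      (measurableSet_lt measurable_norm measurable_const) ?_)
    exact (by fun_prop : Measurable (fun x : EE n => ‖x‖⁻¹ • x)) hS
  rw [← hmp.measure_preimage hms.nullMeasurableSet]
  congr 1
  ext x
  have h1 : (Unitary.linearIsometryEquiv W) x = (W : EE n →L[ℝ] EE n) x := rfl
  simp only [mem_ofPred_eq, mem_preimage, h1, og_norm, map_smul]
  rw [← norm_ne_zero_iff, ← norm_ne_zero_iff (a := (W : EE n →L[ℝ] EE n) x), og_norm]

lemma uniformSphere_integral_comp {n : ℕ} (W : OG n) (h : EE n → ℝ) (hh : Continuous h) :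
    ∫ θ, h ((W : EE n →L[ℝ] EE n) θ) ∂(uniformSphere n) = ∫ θ, h θ ∂(uniformSphere n) := by
  conv_rhs => rw [← uniformSphere_map W]
  rw [integral_map (W : EE n →L[ℝ] EE n).continuous.aemeasurable hh.aestronglyMeasurable]

lemma integrable_of_sphere {α : Type*} [MeasurableSpace α] {μ : Measure α} [IsFiniteMeasure μ]
    {f : α → ℝ} (hf : AEStronglyMeasurable f μ) {C : ℝ} (hC : ∀ᵐ x ∂μ, |f x| ≤ C) :
    Integrable f μ :=
  Integrable.of_bound hf C hC

/-- continuity of the inverse action -/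
lemma cont_act {n : ℕ} {X : Type*} [TopologicalSpace X] {u : X → OG n} {x : X → EE n}
    (hu : Continuous u) (hx : Continuous x) :
    Continuous (fun q => (((u q)⁻¹ : OG n) : EE n →L[ℝ] EE n) (x q)) := by
  have : Continuous (fun q => (((u q)⁻¹ : OG n) : EE n →L[ℝ] EE n)) :=
    continuous_subtype_val.comp hu.inv
  exact this.clm_apply hx

/-- Haar average of a function over an orbit is the average over a sphere. -/
lemma haar_avg {n : ℕ} (hn : 1 ≤ n) {h : EE n → ℝ} (hh : Continuous h) {C : ℝ}
    (hC : ∀ x, |h x| ≤ C * ‖x‖) (y : EE n) :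
    ∫ V, h (((V⁻¹ : OG n) : EE n →L[ℝ] EE n) y) ∂(hO n)
      = ∫ θ, h (‖y‖ • θ) ∂(uniformSphere n) := by
  have := uniformSphere_prob hn
  have h1 : ∀ V : OG n, ∫ θ, h (((V⁻¹ : OG n) : EE n →L[ℝ] EE n) (‖y‖ • θ)) ∂(uniformSphere n)
      = ∫ θ, h (‖y‖ • θ) ∂(uniformSphere n) := by
    intro V
    simp_rw [map_smul]
    exact uniformSphere_integral_comp V⁻¹ (fun θ => h (‖y‖ • θ)) (by fun_prop)
  have h2 : ∀ᵐ θ ∂(uniformSphere n), ∫ V, h (((V⁻¹ : OG n) : EE n →L[ℝ] EE n) (‖y‖ • θ)) ∂(hO n)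
      = ∫ V, h (((V⁻¹ : OG n) : EE n →L[ℝ] EE n) y) ∂(hO n) := by
    filter_upwards [uniformSphere_norm n] with θ hθ
    obtain ⟨W, hW⟩ := orth_trans (x := y) (y := ‖y‖ • θ) (by rw [norm_smul, hθ]; simp)
    rw [← integral_mul_left_eq_self _ W, ← hW]
    simp_rw [og_inv_mul_apply]
  have hIntg : Integrable (Function.uncurry fun (V : OG n) (θ : EE n) =>
      h (((V⁻¹ : OG n) : EE n →L[ℝ] EE n) (‖y‖ • θ))) ((hO n).prod (uniformSphere n)) := by
    refine integrable_of_sphere (C := C * ‖y‖) ?_ ?_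
    · apply Continuous.aestronglyMeasurable
      exact hh.comp (cont_act continuous_fst (by fun_prop))
    · have : ∀ᵐ q ∂((hO n).prod (uniformSphere n)), ‖q.2‖ = 1 :=
        Measure.quasiMeasurePreserving_snd.ae (uniformSphere_norm n)
      filter_upwards [this] with q hq
      refine (hC _).trans ?_
      rw [og_norm, norm_smul, hq]; simp
  calc _ = ∫ θ, ∫ V, h (((V⁻¹ : OG n) : EE n →L[ℝ] EE n) (‖y‖ • θ)) ∂(hO n) ∂(uniformSphere n) := by
        rw [integral_congr_ae h2]; simp
    _ = ∫ V, ∫ θ, h (((V⁻¹ : OG n) : EE n →L[ℝ] EE n) (‖y‖ • θ)) ∂(uniformSphere n) ∂(hO n) := by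
        rw [integral_integral_swap hIntg]
    _ = _ := by simp_rw [h1]; simp

lemma sphere_second_moment {n : ℕ} (hn : 1 ≤ n) (k : EE n) :
    ∫ θ, (inner ℝ k θ) ^ 2 ∂(uniformSphere n) = ‖k‖ ^ 2 / n := by
  have := uniformSphere_prob hn
  have hq : ∀ k k' : EE n, ‖k‖ = ‖k'‖ → ∫ θ, (inner ℝ k θ) ^ 2 ∂(uniformSphere n)
      = ∫ θ, (inner ℝ k' θ) ^ 2 ∂(uniformSphere n) := by
    intro k k' hk
    obtain ⟨W, hW⟩ := orth_trans hk
    rw [← uniformSphere_integral_comp W (fun θ => (inner ℝ k' θ) ^ 2) (by fun_prop), ← hW]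
    simp_rw [og_inner]
  have hi : ∀ k : EE n, Integrable (fun θ => (inner ℝ k θ) ^ 2) (uniformSphere n) := by
    intro k
    refine integrable_of_sphere (C := ‖k‖ ^ 2) (by fun_prop) ?_
    filter_upwards [uniformSphere_norm n] with θ hθ
    rw [abs_of_nonneg (sq_nonneg _)]
    have := abs_real_inner_le_norm k θ
    rw [hθ, mul_one] at this
    exact sq_le_sq' (by linarith [abs_le.1 this]) (abs_le.1 this).2
  let e := EuclideanSpace.basisFun (Fin n) ℝ
  have h1 : ∀ i, ∫ θ, (inner ℝ k θ) ^ 2 ∂(uniformSphere n)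
      = ‖k‖ ^ 2 * ∫ θ, (inner ℝ (e i) θ) ^ 2 ∂(uniformSphere n) := by
    intro i
    rw [hq k (‖k‖ • e i) (by rw [norm_smul, e.norm_eq_one]; simp), ← integral_const_mul]
    simp_rw [real_inner_smul_left, mul_pow]
  have h2 : ∑ i, ∫ θ, (inner ℝ (e i) θ) ^ 2 ∂(uniformSphere n) = 1 := by
    rw [← integral_finsetSum _ fun i _ => hi _]
    have : ∀ᵐ θ ∂(uniformSphere n), ∑ i, (inner ℝ (e i) θ) ^ 2 = 1 := by
      filter_upwards [uniformSphere_norm n] with θ hθ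
      have := e.sum_sq_norm_inner_right θ
      simp only [Real.norm_eq_abs, sq_abs, hθ] at this
      rw [this]; norm_num
    rw [integral_congr_ae this]; simp
  have h3 : (n : ℝ) * ∫ θ, (inner ℝ k θ) ^ 2 ∂(uniformSphere n) = ‖k‖ ^ 2 := by
    have : ∑ i : Fin n, ∫ θ, (inner ℝ k θ) ^ 2 ∂(uniformSphere n) = ‖k‖ ^ 2 := by
      rw [Finset.sum_congr rfl fun i _ => h1 i, ← Finset.mul_sum, h2, mul_one]
    simpa using this
  have hn' : (n : ℝ) ≠ 0 := by positivity
  rw [← h3]; field_simp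

end Sphere

/-- Space of matrices with the Hilbert–Schmidt norm. -/
noncomputable abbrev HS (n : ℕ) := EuclideanSpace ℝ (Fin n × Fin n)

/-- column of a matrix -/
noncomputable def colH {n : ℕ} (H : HS n) (j : Fin n) : EE n := WithLp.toLp 2 fun i => H (i, j)
/-- row of a matrix -/
noncomputable def rowH {n : ℕ} (H : HS n) (i : Fin n) : EE n := WithLp.toLp 2 fun j => H (i, j)
/-- matrix applied to a vector -/
noncomputable def ap {n : ℕ} (H : HS n) (x : EE n) : EE n := ∑ j, x j • colH H j

@[simp] lemma colH_apply {n : ℕ} (H : HS n) (i j : Fin n) : colH H j i = H (i, j) := rfl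
@[simp] lemma rowH_apply {n : ℕ} (H : HS n) (i j : Fin n) : rowH H i j = H (i, j) := rfl

lemma ap_apply {n : ℕ} (H : HS n) (x : EE n) (i : Fin n) : ap H x i = ∑ j, x j * H (i, j) := by
  simp [ap]

lemma ap_inner {n : ℕ} (H : HS n) (x : EE n) (i : Fin n) : ap H x i = inner ℝ (rowH H i) x := by
  rw [ap_apply, PiLp.inner_apply]
  simp

lemma norm_sq_col {n : ℕ} (H : HS n) : ‖H‖ ^ 2 = ∑ j, ‖colH H j‖ ^ 2 := by
  simp_rw [EuclideanSpace.real_norm_sq_eq]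
  rw [Fintype.sum_prod_type, Finset.sum_comm]
  rfl

lemma norm_sq_row {n : ℕ} (H : HS n) : ‖H‖ ^ 2 = ∑ i, ‖rowH H i‖ ^ 2 := by
  simp_rw [EuclideanSpace.real_norm_sq_eq]
  rw [Fintype.sum_prod_type]
  rfl

lemma ap_sub_left {n : ℕ} (H K : HS n) (x : EE n) : ap H x - ap K x = ap (H - K) x := by
  ext i
  simp [ap_apply, mul_sub]

lemma ap_zero_left {n : ℕ} (x : EE n) : ap (0 : HS n) x = 0 := by
  ext i
  simp [ap_apply]

lemma ap_continuous {n : ℕ} : Continuous (fun q : HS n × EE n => ap q.1 q.2) := by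
  refine (PiLp.continuous_toLp 2 _).comp (f := fun q : HS n × EE n => fun i => ap q.1 q.2 i) ?_
  simp only [ap_apply]
  fun_prop

/-- matrix as a linear map -/
noncomputable def apL {n : ℕ} (H : HS n) : EE n →ₗ[ℝ] EE n where
  toFun := ap H
  map_add' x y := by ext i; simp [ap_apply, add_mul, Finset.sum_add_distrib]
  map_smul' c x := by ext i; simp [ap_apply, Finset.mul_sum, mul_assoc]

/-- left multiplication -/
noncomputable def lm {n : ℕ} (U : OG n) : HS n →ₗᵢ[ℝ] HS n where
  toFun H := WithLp.toLp 2 fun p => (U : EE n →L[ℝ] EE n) (colH H p.2) p.1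
  map_add' H K := by
    ext p
    have : colH (H + K) p.2 = colH H p.2 + colH K p.2 := by ext i; simp
    simp [this]
  map_smul' c H := by
    ext p
    have : colH (c • H) p.2 = c • colH H p.2 := by ext i; simp
    simp [this]
  norm_map' H := by
    rw [← sq_eq_sq₀ (norm_nonneg _) (norm_nonneg _), norm_sq_col, norm_sq_col]
    refine Finset.sum_congr rfl fun j _ => ?_
    rw [← og_norm U (colH H j)]
    rfl

lemma lm_ap {n : ℕ} (U : OG n) (H : HS n) (x : EE n) :
    ap (lm U H) x = (U : EE n →L[ℝ] EE n) (ap H x) := by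
  rw [ap, ap, map_sum]
  simp_rw [map_smul]
  rfl

lemma lm_map {n : ℕ} (U : OG n) : (stdGaussian (HS n)).map (lm U) = stdGaussian (HS n) :=
  stdGaussian_map ((lm U).toLinearIsometryEquiv rfl)

lemma lm_continuous {n : ℕ} : Continuous (fun q : OG n × HS n => lm (q.1⁻¹) q.2) := by
  refine (PiLp.continuous_toLp 2 _).comp
    (f := fun q : OG n × HS n => fun p : Fin n × Fin n =>
      ((q.1⁻¹ : OG n) : EE n →L[ℝ] EE n) (colH q.2 p.2) p.1) ?_
  refine continuous_pi fun p => ?_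
  have h1 : Continuous (fun q : OG n × HS n => colH q.2 p.2) := by
    refine (PiLp.continuous_toLp 2 _).comp (f := fun q : OG n × HS n => fun i => q.2 (i, p.2)) ?_
    fun_prop
  have := cont_act (n := n) (u := fun q : OG n × HS n => q.1) continuous_fst h1
  exact (EuclideanSpace.proj (𝕜 := ℝ) p.1).continuous.comp this

/-- first absolute moment of a standard Gaussian. -/
noncomputable def c0 : ℝ := ∫ z, |z| ∂(gaussianReal 0 1)

lemma c0_pos : 0 < c0 := by
  have hi : Integrable (fun z : ℝ => |z|) (gaussianReal 0 1) := by
    have := (memLp_id_gaussianReal (μ := 0) (v := 1) 1).integrable (by simp)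
    exact this.abs
  rw [c0, integral_pos_iff_support_of_nonneg (fun _ => abs_nonneg _) hi]
  have : Function.support (fun z : ℝ => |z|) = {0}ᶜ := by ext; simp
  rw [this, prob_compl_eq_one_sub (measurableSet_singleton _)]
  have := nullSingletonClass_gaussianReal (μ := 0) (v := 1) (by simp)
  simp

lemma lower_gauss {n : ℕ} (hn : 1 ≤ n) (x : EE n) (hx : ‖x‖ = 1) :
    c0 * √n ≤ ∫ H, ‖ap H x‖ ∂(stdGaussian (HS n)) := by
  have hcoord : ∀ i : Fin n, (Integrable (fun H : HS n => |ap H x i|) (stdGaussian (HS n))) ∧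
      ∫ H, |ap H x i| ∂(stdGaussian (HS n)) = c0 := by
    intro i
    let u : HS n := WithLp.toLp 2 fun p => if p.1 = i then x p.2 else 0
    have hu : ‖u‖ = 1 := by
      rw [← sq_eq_sq₀ (norm_nonneg _) zero_le_one, EuclideanSpace.real_norm_sq_eq,
        Fintype.sum_prod_type]
      simp only [u]
      rw [Finset.sum_eq_single i (by intro b _ hb; simp [hb]) (by simp)]
      simp only [if_true]
      rw [← EuclideanSpace.real_norm_sq_eq, hx]
    have hl : ∀ H : HS n, (innerSL ℝ u) H = ap H x i := by
      intro H
      rw [ap_apply, innerSL_apply_apply, PiLp.inner_apply, Fintype.sum_prod_type]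
      rw [Finset.sum_eq_single i (by intro b _ hb; simp [u, hb]) (by simp)]
      simp [u, mul_comm]
    have h := IsGaussian.map_eq_gaussianReal (μ := stdGaussian (HS n)) (innerSL ℝ u)
    rw [integral_strongDual_stdGaussian, variance_dual_stdGaussian, innerSL_apply_norm, hu] at h
    simp only [one_pow, Real.toNNReal_one] at h
    have hi : Integrable (fun z : ℝ => |z|) (gaussianReal 0 1) := by
      have := (memLp_id_gaussianReal (μ := 0) (v := 1) 1).integrable (by simp)
      exact this.abs
    constructor
    · rw [← h, integrable_map_measure (by fun_prop) (by fun_prop)] at hi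
      simp only [Function.comp_def, hl] at hi
      exact hi
    · rw [c0, ← h, integral_map (by fun_prop) (by fun_prop)]
      simp only [hl]
  have hpt : ∀ H : HS n, (∑ i, |ap H x i|) ≤ √n * ‖ap H x‖ := by
    intro H
    have h1 := sq_sum_le_card_mul_sum_sq (s := Finset.univ) (f := fun i => |ap H x i|)
    simp only [sq_abs] at h1
    rw [← EuclideanSpace.real_norm_sq_eq, Finset.card_univ, Fintype.card_fin] at h1
    apply le_of_sq_le_sq _ (by positivity)
    rw [mul_pow, Real.sq_sqrt (by positivity)]
    exact h1
  have hap : Integrable (fun H : HS n => ‖ap H x‖) (stdGaussian (HS n)) := by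
    refine Integrable.mono' (integrable_finsetSum Finset.univ fun i _ => (hcoord i).1) ?_ ?_
    · exact (ap_continuous.comp (by fun_prop : Continuous fun H : HS n => (H, x))).norm.aestronglyMeasurable
    · refine Filter.Eventually.of_forall fun H => ?_
      rw [norm_norm, EuclideanSpace.norm_eq]
      apply Real.sqrt_le_iff.2 ⟨by positivity, ?_⟩
      simp only [Real.norm_eq_abs]
      exact Finset.sum_sq_le_sq_sum_of_nonneg fun i _ => abs_nonneg _
  have h2 : (n : ℝ) * c0 ≤ √n * ∫ H, ‖ap H x‖ ∂(stdGaussian (HS n)) := by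
    rw [← integral_const_mul]
    calc (n : ℝ) * c0 = ∫ H, ∑ i, |ap H x i| ∂(stdGaussian (HS n)) := by
          rw [integral_finsetSum _ fun i _ => (hcoord i).1]
          simp [(hcoord _).2]
      _ ≤ _ := integral_mono (integrable_finsetSum _ fun i _ => (hcoord i).1)
          (hap.const_mul _) hpt
  have hs : 0 < √(n : ℝ) := Real.sqrt_pos.2 (by positivity)
  have hs2 : √(n : ℝ) * √n = n := Real.mul_self_sqrt (by positivity)
  refine le_of_mul_le_mul_left (le_trans (le_of_eq ?_) h2) hs
  linear_combination c0 * hs2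

/-- Average of `g` over the image of the unit sphere of `ℝˢ`. -/
noncomputable def psi {n s : ℕ} (g : EE n → ℝ) (ι : EE s →ₗᵢ[ℝ] EE n) (H : HS n) : ℝ :=
  ∫ θ, g (ap H (ι θ)) ∂(uniformSphere s)

lemma sphere_int {n s : ℕ} (hs : 1 ≤ s) {g : EE n → ℝ} {C : ℝ} (hg : Continuous g)
    (hC : ∀ x, |g x| ≤ C * ‖x‖) {T : EE s → EE n} (hT : Continuous T) {B : ℝ} (hC0 : 0 ≤ C)
    (hB : ∀ θ, ‖θ‖ = 1 → ‖T θ‖ ≤ B) :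
    Integrable (fun θ => g (T θ)) (uniformSphere s) := by
  have := uniformSphere_prob hs
  refine integrable_of_sphere (C := C * B) (hg.comp hT).aestronglyMeasurable ?_
  filter_upwards [uniformSphere_norm s] with θ hθ
  exact (hC _).trans (mul_le_mul_of_nonneg_left (hB θ hθ) hC0)

lemma ap_cont_right {n s : ℕ} (ι : EE s →ₗᵢ[ℝ] EE n) (H : HS n) :
    Continuous (fun θ : EE s => ap H (ι θ)) :=
  ap_continuous.comp (continuous_const.prodMk ι.continuous)

lemma ap_sq {n s : ℕ} (hs : 1 ≤ s) (ι : EE s →ₗᵢ[ℝ] EE n) (K : HS n) :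
    Integrable (fun θ => ‖ap K (ι θ)‖ ^ 2) (uniformSphere s) ∧
    ∫ θ, ‖ap K (ι θ)‖ ^ 2 ∂(uniformSphere s) ≤ ‖K‖ ^ 2 / s := by
  have := uniformSphere_prob hs
  let A := ContinuousLinearMap.adjoint ι.toContinuousLinearMap
  have hA : ∀ (k : EE n) (θ : EE s), inner ℝ k (ι θ) = inner ℝ (A k) θ := by
    intro k θ
    exact (ContinuousLinearMap.adjoint_inner_left ι.toContinuousLinearMap θ k).symm
  have hAn : ∀ k : EE n, ‖A k‖ ≤ ‖k‖ := by
    intro k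
    have h1 : ‖A‖ ≤ 1 := by
      rw [LinearIsometryEquiv.norm_map]
      exact ι.norm_toContinuousLinearMap_le
    calc ‖A k‖ ≤ ‖A‖ * ‖k‖ := A.le_opNorm k
      _ ≤ 1 * ‖k‖ := by gcongr
      _ = _ := one_mul _
  have hexp : ∀ θ : EE s, ‖ap K (ι θ)‖ ^ 2 = ∑ i, (inner ℝ (A (rowH K i)) θ) ^ 2 := by
    intro θ
    rw [EuclideanSpace.real_norm_sq_eq]
    simp_rw [ap_inner, hA]
  have hi : ∀ k : EE s, Integrable (fun θ => (inner ℝ k θ) ^ 2) (uniformSphere s) := by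
    intro k
    refine integrable_of_sphere (C := ‖k‖ ^ 2) (by fun_prop) ?_
    filter_upwards [uniformSphere_norm s] with θ hθ
    rw [abs_of_nonneg (sq_nonneg _)]
    have := abs_real_inner_le_norm k θ
    rw [hθ, mul_one] at this
    exact sq_le_sq' (by linarith [abs_le.1 this]) (abs_le.1 this).2
  simp_rw [hexp]
  refine ⟨integrable_finsetSum _ fun i _ => hi _, ?_⟩
  rw [integral_finsetSum _ fun i _ => hi _]
  simp_rw [sphere_second_moment hs]
  rw [← Finset.sum_div, norm_sq_row]
  gcongr
  exact hAn _

lemma ap_norm_bound {n : ℕ} (H : HS n) (x : EE n) : ‖ap H x‖ ≤ ‖H‖ * ‖x‖ := by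
  apply le_of_sq_le_sq _ (by positivity)
  rw [EuclideanSpace.real_norm_sq_eq, mul_pow, norm_sq_row, Finset.sum_mul]
  refine Finset.sum_le_sum fun i _ => ?_
  rw [ap_inner, ← mul_pow]
  have := abs_real_inner_le_norm (rowH H i) x
  exact sq_le_sq' (by linarith [abs_le.1 this]) (abs_le.1 this).2

lemma ap_first {n s : ℕ} (hs : 1 ≤ s) (ι : EE s →ₗᵢ[ℝ] EE n) (K : HS n) :
    ∫ θ, ‖ap K (ι θ)‖ ∂(uniformSphere s) ≤ ‖K‖ / √s := by
  have := uniformSphere_prob hs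
  obtain ⟨h1, h2⟩ := ap_sq hs ι K
  have h3 : Integrable (fun θ => ‖ap K (ι θ)‖) (uniformSphere s) := by
    refine sphere_int hs (g := fun x => ‖x‖) (C := 1) continuous_norm (by simp)
      (ap_cont_right ι K) zero_le_one (B := ‖K‖) fun θ hθ => ?_
    have := ap_norm_bound K (ι θ)
    rwa [ι.norm_map, hθ, mul_one] at this
  have h4 := (even_two.convexOn_pow (𝕜 := ℝ)).map_integral_le (by fun_prop) isClosed_univ
    (by simp) h3 h1
  apply le_of_sq_le_sq _ (by positivity)
  rw [div_pow, Real.sq_sqrt (by positivity)]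
  exact h4.trans h2

lemma psi_lip {n s : ℕ} (hs : 1 ≤ s) {g : EE n → ℝ} {L : ℝ≥0} (hg : LipschitzWith L g)
    (hg0 : g 0 = 0) (ι : EE s →ₗᵢ[ℝ] EE n) :
    LipschitzWith (L / NNReal.sqrt s) (psi g ι) := by
  have := uniformSphere_prob hs
  have hgb : ∀ x, |g x| ≤ L * ‖x‖ := by
    intro x
    have := hg.dist_le_mul x 0
    rwa [dist_zero_right, Real.dist_eq, hg0, sub_zero] at this
  have hb : ∀ (H : HS n) (θ : EE s), ‖θ‖ = 1 → ‖ap H (ι θ)‖ ≤ ‖H‖ := by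
    intro H θ hθ
    have := ap_norm_bound H (ι θ)
    rwa [ι.norm_map, hθ, mul_one] at this
  have hIntg : ∀ H, Integrable (fun θ => g (ap H (ι θ))) (uniformSphere s) := fun H =>
    sphere_int hs hg.continuous hgb (ap_cont_right ι H) L.2 (hb H)
  refine LipschitzWith.of_dist_le_mul fun H K => ?_
  rw [dist_eq_norm, psi, psi, ← integral_sub (hIntg H) (hIntg K)]
  have hn : Integrable (fun θ => ‖ap (H - K) (ι θ)‖) (uniformSphere s) :=
    sphere_int hs (g := fun x => ‖x‖) (C := 1) continuous_norm (by simp)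
      (ap_cont_right ι _) zero_le_one (hb _)
  calc _ ≤ ∫ θ, L * ‖ap (H - K) (ι θ)‖ ∂(uniformSphere s) := by
        apply norm_integral_le_of_norm_le (hn.const_mul _)
        refine Filter.Eventually.of_forall fun θ => ?_
        have := hg.dist_le_mul (ap H (ι θ)) (ap K (ι θ))
        rwa [dist_eq_norm, dist_eq_norm, ap_sub_left] at this
    _ = L * ∫ θ, ‖ap (H - K) (ι θ)‖ ∂(uniformSphere s) := integral_const_mul _ _
    _ ≤ L * (‖H - K‖ / √s) := by
        gcongr
        exact ap_first hs ι _
    _ = _ := by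
        rw [dist_eq_norm]
        push_cast
        rw [mul_div_assoc', div_mul_eq_mul_div]

/-- A subspace of dimension at most `s` embeds isometrically in `ℝˢ`. -/
lemma exists_isom {n s : ℕ} (R : Submodule ℝ (EE n)) (h : Module.finrank ℝ R ≤ s) :
    Nonempty (R →ₗᵢ[ℝ] EE s) := by
  let v := stdOrthonormalBasis ℝ R
  let w : Fin (Module.finrank ℝ R) → EE s := fun i => EuclideanSpace.basisFun (Fin s) ℝ (Fin.castLE h i)
  have hw : Orthonormal ℝ w :=
    (EuclideanSpace.basisFun (Fin s) ℝ).orthonormal.comp _ (Fin.castLE_injective h)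
  refine ⟨(v.toBasis.constr ℝ w).isometryOfOrthonormal (v := v.toBasis) ?_ ?_⟩
  · simp [v.orthonormal]
  · convert hw using 1
    ext1 i
    simp

lemma meas_int {α β : Type*} [TopologicalSpace α] [MeasurableSpace α] [BorelSpace α]
    [SecondCountableTopology α] [TopologicalSpace β] [MeasurableSpace β] [BorelSpace β]
    [SecondCountableTopology β] {ν : Measure β} [SFinite ν] {F : α → β → ℝ}
    (hF : Continuous (Function.uncurry F)) : Measurable (fun a => ∫ b, F a b ∂ν) := by
  have : StronglyMeasurable (Function.uncurry F) := hF.measurable.stronglyMeasurable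
  exact this.integral_prod_right.measurable

/-- Bounds for a homogeneous Lipschitz function. -/
structure HomLip {n : ℕ} (g : EE n → ℝ) (L : ℝ≥0) : Prop where
  lip : LipschitzWith L g
  hom : ∀ (c : ℝ) (x : EE n), 0 ≤ c → g (c • x) = c * g x

lemma HomLip.zero {n : ℕ} {g : EE n → ℝ} {L : ℝ≥0} (h : HomLip g L) : g 0 = 0 := by
  simpa using h.hom 0 0 le_rfl

lemma HomLip.bound {n : ℕ} {g : EE n → ℝ} {L : ℝ≥0} (h : HomLip g L) (x : EE n) :
    |g x| ≤ L * ‖x‖ := by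
  have := h.lip.dist_le_mul x 0
  rwa [dist_zero_right, Real.dist_eq, h.zero, sub_zero] at this

lemma step_two {n s : ℕ} (hs : 1 ≤ s) {g : EE n → ℝ} {L : ℝ≥0} (hg : HomLip g L)
    (ι : EE s →ₗᵢ[ℝ] EE n) (T : EE s →ₗ[ℝ] EE n) :
    ∫⁻ U, ENNReal.ofReal (exp ((∫ θ, ‖T θ‖ ∂(uniformSphere s)) *
        ∫ θ, g (((U⁻¹ : OG n) : EE n →L[ℝ] EE n) (ι θ)) ∂(uniformSphere s))) ∂(hO n)
      ≤ ∫⁻ U, ENNReal.ofReal (exp (∫ θ, g (((U⁻¹ : OG n) : EE n →L[ℝ] EE n) (T θ))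
        ∂(uniformSphere s))) ∂(hO n) := by
  have := uniformSphere_prob hs
  have hTc : Continuous T := T.continuous_of_finiteDimensional
  obtain ⟨J⟩ := exists_isom (s := s) (LinearMap.range T) (by
    simpa using LinearMap.finrank_range_le T)
  let S : EE s → EE s := fun x => J ⟨T x, LinearMap.mem_range_self T x⟩
  have hSc : Continuous S := J.continuous.comp (hTc.subtype_mk _)
  have hSn : ∀ x, ‖S x‖ = ‖T x‖ := fun x => J.norm_map _
  have hTb : ∃ B, ∀ θ : EE s, ‖θ‖ = 1 → ‖T θ‖ ≤ B := by
    refine ⟨‖T.toContinuousLinearMap‖, fun θ hθ => ?_⟩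
    have := T.toContinuousLinearMap.le_opNorm θ
    rwa [hθ, mul_one] at this
  obtain ⟨B, hB⟩ := hTb
  -- invariance
  have key : ∀ V : OG s, ∫⁻ U, ENNReal.ofReal (exp (∫ θ, g (((U⁻¹ : OG n) : EE n →L[ℝ] EE n) (T θ))
        ∂(uniformSphere s))) ∂(hO n) =
      ∫⁻ U, ENNReal.ofReal (exp (∫ θ, g (((U⁻¹ : OG n) : EE n →L[ℝ] EE n)
        (ι (((V⁻¹ : OG s) : EE s →L[ℝ] EE s) (S θ)))) ∂(uniformSphere s))) ∂(hO n) := by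
    intro V
    let Vi := (Unitary.linearIsometryEquiv (V⁻¹ : OG s)).toLinearIsometry
    obtain ⟨W, hW⟩ := og_of_isometry (((ι.comp Vi).comp J).extend)
    have hWT : ∀ x, (W : EE n →L[ℝ] EE n) (T x) = ι (((V⁻¹ : OG s) : EE s →L[ℝ] EE s) (S x)) := by
      intro x
      have h1 : T x = ((⟨T x, LinearMap.mem_range_self T x⟩ : LinearMap.range T) : EE n) := rfl
      rw [hW, h1, LinearIsometry.extend_apply]
      rfl
    conv_rhs => rw [← lintegral_mul_left_eq_self _ W]
    simp_rw [← hWT, og_inv_mul_apply]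
  have hc3 : Continuous (Function.uncurry fun (q : OG s × OG n) (θ : EE s) =>
      g (((q.2⁻¹ : OG n) : EE n →L[ℝ] EE n) (ι (((q.1⁻¹ : OG s) : EE s →L[ℝ] EE s) (S θ))))) := by
    refine hg.lip.continuous.comp (cont_act (continuous_snd.comp continuous_fst) ?_)
    exact ι.continuous.comp (cont_act (continuous_fst.comp continuous_fst)
      (hSc.comp continuous_snd))
  have hm := meas_int (ν := uniformSphere s) hc3
  calc _ ≤ ∫⁻ U, ∫⁻ V, ENNReal.ofReal (exp (∫ θ, g (((U⁻¹ : OG n) : EE n →L[ℝ] EE n)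
        (ι (((V⁻¹ : OG s) : EE s →L[ℝ] EE s) (S θ)))) ∂(uniformSphere s))) ∂(hO s) ∂(hO n) := by
        refine lintegral_mono fun U => ?_
        let h : EE s → ℝ := fun x => g (((U⁻¹ : OG n) : EE n →L[ℝ] EE n) (ι x))
        have hh : Continuous h := hg.lip.continuous.comp
          (((U⁻¹ : OG n) : EE n →L[ℝ] EE n).continuous.comp ι.continuous)
        have hhb : ∀ x, |h x| ≤ L * ‖x‖ := fun x => by
          have := hg.bound (((U⁻¹ : OG n) : EE n →L[ℝ] EE n) (ι x))
          rwa [og_norm, ι.norm_map] at this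
        have hIntg : Integrable (Function.uncurry fun (V : OG s) (θ : EE s) =>
            h (((V⁻¹ : OG s) : EE s →L[ℝ] EE s) (S θ))) ((hO s).prod (uniformSphere s)) := by
          refine integrable_of_sphere (C := L * B) ?_ ?_
          · apply Continuous.aestronglyMeasurable
            exact hh.comp (cont_act continuous_fst (hSc.comp continuous_snd))
          · have : ∀ᵐ q ∂((hO s).prod (uniformSphere s)), ‖q.2‖ = 1 :=
              Measure.quasiMeasurePreserving_snd.ae (uniformSphere_norm s)
            filter_upwards [this] with q hq
            refine (hhb _).trans ?_
            rw [og_norm, hSn]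
            exact mul_le_mul_of_nonneg_left (hB _ hq) L.2
        have h1 : (∫ θ, ‖T θ‖ ∂(uniformSphere s)) * ∫ θ, h θ ∂(uniformSphere s) =
            ∫ V, ∫ θ, h (((V⁻¹ : OG s) : EE s →L[ℝ] EE s) (S θ)) ∂(uniformSphere s) ∂(hO s) := by
          rw [integral_integral_swap hIntg]
          simp_rw [haar_avg hs hh hhb, hSn]
          rw [← integral_mul_const]
          congr 1
          ext θ
          rw [← integral_const_mul]
          congr 1
          ext x
          simp only [h, map_smul]
          rw [hg.hom _ _ (norm_nonneg _)]
        change ENNReal.ofReal (exp ((∫ θ, ‖T θ‖ ∂(uniformSphere s)) * ∫ θ, h θ ∂(uniformSphere s)))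
          ≤ _
        rw [h1]
        exact jexp hIntg.integral_prod_left
    _ = ∫⁻ V, ∫⁻ U, ENNReal.ofReal (exp (∫ θ, g (((U⁻¹ : OG n) : EE n →L[ℝ] EE n)
        (ι (((V⁻¹ : OG s) : EE s →L[ℝ] EE s) (S θ)))) ∂(uniformSphere s))) ∂(hO n) ∂(hO s) := by
        refine (lintegral_lintegral_swap ?_).symm
        exact (ENNReal.measurable_ofReal.comp (measurable_exp.comp hm)).aemeasurable
    _ = _ := by
        simp_rw [← key]
        simp

lemma fixed_conc {n s : ℕ} (hn : 1 ≤ n) (hs : 1 ≤ s) (ι : EE s →ₗᵢ[ℝ] EE n) :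
    ∃ l : ℝ, c0 * √n ≤ l ∧ ∀ (g : EE n → ℝ) (L : ℝ≥0), HomLip g L →
      ∫ θ, g θ ∂(uniformSphere n) = 0 →
      ∫⁻ U, ENNReal.ofReal (exp (l *
        ∫ θ, g (((U⁻¹ : OG n) : EE n →L[ℝ] EE n) (ι θ)) ∂(uniformSphere s))) ∂(hO n)
      ≤ ENNReal.ofReal (exp (π ^ 2 / 8 * (L ^ 2 / s))) := by
  have := uniformSphere_prob hs
  have hnl : LipschitzWith 1 (fun x : EE n => ‖x‖) := lipschitzWith_one_norm
  have hai := lip_integrable (psi_lip hs hnl norm_zero ι)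
  refine ⟨∫ H, psi (fun x => ‖x‖) ι H ∂(stdGaussian (HS n)), ?_, ?_⟩
  · have hIntg : Integrable (Function.uncurry fun (H : HS n) (θ : EE s) => ‖ap H (ι θ)‖)
        ((stdGaussian (HS n)).prod (uniformSphere s)) := by
      have h1 : Integrable (fun q : HS n × EE s => ‖q.1‖)
          ((stdGaussian (HS n)).prod (uniformSphere s)) :=
        ((IsGaussian.integrable_id (μ := stdGaussian (HS n))).norm).comp_fst _
      refine h1.mono' ?_ ?_
      · apply Continuous.aestronglyMeasurable
        exact (ap_continuous.comp (continuous_fst.prodMk (ι.continuous.comp continuous_snd))).norm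
      · have : ∀ᵐ q ∂((stdGaussian (HS n)).prod (uniformSphere s)), ‖q.2‖ = 1 :=
          Measure.quasiMeasurePreserving_snd.ae (uniformSphere_norm s)
        filter_upwards [this] with q hq
        have := ap_norm_bound q.1 (ι q.2)
        rw [ι.norm_map, hq, mul_one] at this
        simpa [Function.uncurry] using this
    simp only [psi]
    rw [integral_integral_swap hIntg]
    calc c0 * √n = ∫ θ : EE s, c0 * √n ∂(uniformSphere s) := by simp
      _ ≤ _ := by
        refine integral_mono_ae (integrable_const _) hIntg.integral_prod_right ?_
        filter_upwards [uniformSphere_norm s] with θ hθ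
        exact lower_gauss hn (ι θ) (by rw [ι.norm_map, hθ])
  intro g L hg hmean
  have hpl := psi_lip hs hg.lip hg.zero ι
  have hpi := lip_integrable hpl
  have hmX : Measurable fun U : OG n =>
      ∫ θ, g (((U⁻¹ : OG n) : EE n →L[ℝ] EE n) (ι θ)) ∂(uniformSphere s) :=
    meas_int (hg.lip.continuous.comp (cont_act continuous_fst (ι.continuous.comp continuous_snd)))
  have hmP : Measurable fun q : OG n × HS n => psi g ι (lm (q.1⁻¹) q.2) :=
    (hpl.continuous.comp lm_continuous).measurable
  have hpsi : ∀ (U : OG n) (H : HS n), psi g ι (lm U⁻¹ H) =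
      ∫ θ, g (((U⁻¹ : OG n) : EE n →L[ℝ] EE n) (ap H (ι θ))) ∂(uniformSphere s) := by
    intro U H
    simp only [psi, lm_ap]
  have hmean0 : ∫ H, psi g ι H ∂(stdGaussian (HS n)) = 0 := by
    have h1 : ∀ U : OG n, ∫ H, psi g ι (lm U⁻¹ H) ∂(stdGaussian (HS n)) =
        ∫ H, psi g ι H ∂(stdGaussian (HS n)) := by
      intro U
      conv_rhs => rw [← lm_map U⁻¹]
      rw [integral_map (lm U⁻¹).continuous.aemeasurable hpl.continuous.aestronglyMeasurable]
    have h2 : ∀ H : HS n, ∫ U, psi g ι (lm U⁻¹ H) ∂(hO n) = 0 := by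
      intro H
      simp_rw [hpsi]
      rw [integral_integral_swap]
      · have h3 : ∀ θ : EE s, ∫ U, g (((U⁻¹ : OG n) : EE n →L[ℝ] EE n) (ap H (ι θ))) ∂(hO n)
            = 0 := by
          intro θ
          rw [haar_avg hn hg.lip.continuous hg.bound]
          simp_rw [hg.hom _ _ (norm_nonneg _)]
          rw [integral_const_mul, hmean, mul_zero]
        simp_rw [h3]
        simp
      · refine integrable_of_sphere (C := L * ‖H‖) ?_ ?_
        · apply Continuous.aestronglyMeasurable
          exact hg.lip.continuous.comp (cont_act continuous_fst
            ((ap_cont_right ι H).comp continuous_snd))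
        · have : ∀ᵐ q ∂((hO n).prod (uniformSphere s)), ‖q.2‖ = 1 :=
            Measure.quasiMeasurePreserving_snd.ae (uniformSphere_norm s)
          filter_upwards [this] with q hq
          refine (hg.bound _).trans ?_
          rw [og_norm]
          have := ap_norm_bound H (ι q.2)
          rw [ι.norm_map, hq, mul_one] at this
          exact mul_le_mul_of_nonneg_left this L.2
    have h4 : Integrable (Function.uncurry fun (U : OG n) (H : HS n) => psi g ι (lm U⁻¹ H))
        ((hO n).prod (stdGaussian (HS n))) := by
      have h5 : Integrable (fun q : OG n × HS n => ((L / NNReal.sqrt s : ℝ≥0) : ℝ) * ‖q.2‖)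
          ((hO n).prod (stdGaussian (HS n))) :=
        ((IsGaussian.integrable_id (μ := stdGaussian (HS n))).norm.const_mul _).comp_snd _
      refine h5.mono' hmP.aestronglyMeasurable (Filter.Eventually.of_forall fun q => ?_)
      have h6 := hpl.dist_le_mul (lm q.1⁻¹ q.2) 0
      have h7 : psi g ι 0 = 0 := by simp [psi, ap_zero_left, hg.zero]
      rw [dist_zero_right, Real.dist_eq, h7, sub_zero, (lm q.1⁻¹).norm_map] at h6
      exact h6
    calc _ = ∫ U, ∫ H, psi g ι (lm U⁻¹ H) ∂(stdGaussian (HS n)) ∂(hO n) := by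
          simp_rw [h1]; simp
      _ = 0 := by
          rw [integral_integral_swap h4]
          simp_rw [h2]; simp
  calc _ ≤ ∫⁻ U, ∫⁻ H, ENNReal.ofReal (exp (psi (fun x => ‖x‖) ι H *
        ∫ θ, g (((U⁻¹ : OG n) : EE n →L[ℝ] EE n) (ι θ)) ∂(uniformSphere s)))
          ∂(stdGaussian (HS n)) ∂(hO n) := by
        refine lintegral_mono fun U => ?_
        rw [← integral_mul_const]
        exact jexp (hai.mul_const _)
    _ = ∫⁻ H, ∫⁻ U, ENNReal.ofReal (exp (psi (fun x => ‖x‖) ι H *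
        ∫ θ, g (((U⁻¹ : OG n) : EE n →L[ℝ] EE n) (ι θ)) ∂(uniformSphere s)))
          ∂(hO n) ∂(stdGaussian (HS n)) := by
        refine lintegral_lintegral_swap ?_
        refine (ENNReal.measurable_ofReal.comp (measurable_exp.comp ?_)).aemeasurable
        exact ((psi_lip hs hnl norm_zero ι).continuous.measurable.comp measurable_snd).mul
          (hmX.comp measurable_fst)
    _ ≤ ∫⁻ H, ∫⁻ U, ENNReal.ofReal (exp (psi g ι (lm U⁻¹ H))) ∂(hO n) ∂(stdGaussian (HS n)) := by
        refine lintegral_mono fun H => ?_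
        simp_rw [hpsi]
        exact step_two hs hg ι ((apL H).comp ι.toLinearMap)
    _ = ∫⁻ U, ∫⁻ H, ENNReal.ofReal (exp (psi g ι (lm U⁻¹ H))) ∂(stdGaussian (HS n)) ∂(hO n) := by
        refine (lintegral_lintegral_swap ?_).symm
        exact (ENNReal.measurable_ofReal.comp (measurable_exp.comp hmP)).aemeasurable
    _ = ∫⁻ U, ∫⁻ H, ENNReal.ofReal (exp (psi g ι H)) ∂(stdGaussian (HS n)) ∂(hO n) := by
        refine lintegral_congr fun U => ?_
        conv_rhs => rw [← lm_map U⁻¹]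
        rw [lintegral_map _ (lm U⁻¹).continuous.measurable]
        exact ENNReal.measurable_ofReal.comp (measurable_exp.comp hpl.continuous.measurable)
    _ = ∫⁻ H, ENNReal.ofReal (exp (psi g ι H)) ∂(stdGaussian (HS n)) := by simp
    _ ≤ _ := by
        have := gauss_conc hpl
        simp only [hmean0, sub_zero] at this
        refine this.trans (le_of_eq ?_)
        congr 3
        push_cast
        rw [div_pow, Real.sq_sqrt (by positivity)]

lemma fixed_conc' {n s : ℕ} (hn : 1 ≤ n) (hs : 1 ≤ s) (ι : EE s →ₗᵢ[ℝ] EE n)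
    {g : EE n → ℝ} {L : ℝ≥0} (hg : HomLip g L) (hmean : ∫ θ, g θ ∂(uniformSphere n) = 0) :
    ∫⁻ U, ENNReal.ofReal (exp (
        ∫ θ, g (((U⁻¹ : OG n) : EE n →L[ℝ] EE n) (ι θ)) ∂(uniformSphere s))) ∂(hO n)
      ≤ ENNReal.ofReal (exp (π ^ 2 / 8 * (L ^ 2 / (c0 ^ 2 * n * s)))) := by
  obtain ⟨l, hl, h⟩ := fixed_conc hn hs ι
  have hn0 : (0 : ℝ) < n := by exact_mod_cast hn
  have hs0 : (0 : ℝ) < s := by exact_mod_cast hs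
  have hcn : 0 < c0 * √n := mul_pos c0_pos (Real.sqrt_pos.2 hn0)
  have hl0 : 0 < l := hcn.trans_le hl
  let k : ℝ≥0 := ⟨l⁻¹, by positivity⟩
  have hk : (k : ℝ) = l⁻¹ := rfl
  have hg' : HomLip (fun x => l⁻¹ * g x) (k * L) := by
    refine ⟨LipschitzWith.of_dist_le_mul fun x y => ?_, fun c x hc => ?_⟩
    · have := hg.lip.dist_le_mul x y
      rw [Real.dist_eq] at this ⊢
      rw [← mul_sub, abs_mul, abs_of_pos (by positivity), NNReal.coe_mul, hk, mul_assoc]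
      gcongr
    · rw [hg.hom c x hc]; ring
  have h1 := h _ _ hg' (by rw [integral_const_mul, hmean, mul_zero])
  simp_rw [integral_const_mul, mul_inv_cancel_left₀ hl0.ne'] at h1
  refine h1.trans (ENNReal.ofReal_le_ofReal (exp_le_exp.2 ?_))
  rw [NNReal.coe_mul, hk, mul_pow, inv_pow, inv_mul_eq_div, div_div]
  have h2 : c0 ^ 2 * n ≤ l ^ 2 := by
    have := pow_le_pow_left₀ hcn.le hl 2
    rwa [mul_pow, Real.sq_sqrt hn0.le] at this
  have := c0_pos
  gcongr

/-- adjoint of an isometric embedding -/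
noncomputable def adj {n s : ℕ} (ι : EE s →ₗᵢ[ℝ] EE n) : EE n →L[ℝ] EE s :=
  ContinuousLinearMap.adjoint ι.toContinuousLinearMap

lemma adj_inner {n s : ℕ} (ι : EE s →ₗᵢ[ℝ] EE n) (x : EE n) (y : EE s) :
    inner ℝ (adj ι x) y = inner ℝ x (ι y) :=
  ContinuousLinearMap.adjoint_inner_left ι.toContinuousLinearMap y x

lemma adj_norm {n s : ℕ} (ι : EE s →ₗᵢ[ℝ] EE n) (x : EE n) : ‖adj ι x‖ ≤ ‖x‖ := by
  have h1 : ‖adj ι‖ ≤ 1 := by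
    rw [adj, LinearIsometryEquiv.norm_map]
    exact ι.norm_toContinuousLinearMap_le
  calc ‖adj ι x‖ ≤ ‖adj ι‖ * ‖x‖ := (adj ι).le_opNorm x
    _ ≤ 1 * ‖x‖ := by gcongr
    _ = _ := one_mul _

lemma adj_comp_self {n s : ℕ} (ι : EE s →ₗᵢ[ℝ] EE n) (y : EE s) : adj ι (ι y) = y := by
  refine ext_inner_right ℝ fun z => ?_
  rw [adj_inner, ι.inner_map_map]

lemma proj_avg {n s : ℕ} (hn : 1 ≤ n) (hs : 1 ≤ s) {f : EE n → ℝ} {L : ℝ≥0} (hf : HomLip f L)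
    (ι : EE s →ₗᵢ[ℝ] EE n) :
    ∫ x, f (ι (adj ι x)) ∂(uniformSphere n) =
      (∫ x, ‖adj ι x‖ ∂(uniformSphere n)) * ∫ θ, f (ι θ) ∂(uniformSphere s) := by
  have := uniformSphere_prob hn
  have := uniformSphere_prob hs
  let h : EE s → ℝ := fun y => f (ι y)
  have hh : Continuous h := hf.lip.continuous.comp ι.continuous
  have hhb : ∀ y, |h y| ≤ L * ‖y‖ := fun y => by
    have := hf.bound (ι y)
    rwa [ι.norm_map] at this
  have hV : ∀ V : OG s, ∫ x, h (((V⁻¹ : OG s) : EE s →L[ℝ] EE s) (adj ι x)) ∂(uniformSphere n)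
      = ∫ x, h (adj ι x) ∂(uniformSphere n) := by
    intro V
    obtain ⟨W, hW⟩ := orth_ext ι (ι.comp (Unitary.linearIsometryEquiv V).toLinearIsometry)
    have hW' : ∀ y, (W : EE n →L[ℝ] EE n) (ι y) = ι ((V : EE s →L[ℝ] EE s) y) := hW
    have hc : ∀ x, adj ι (((W⁻¹ : OG n) : EE n →L[ℝ] EE n) x) =
        ((V⁻¹ : OG s) : EE s →L[ℝ] EE s) (adj ι x) := by
      intro x
      refine ext_inner_right ℝ fun z => ?_
      rw [adj_inner, ← og_inner W, og_apply_inv, hW', ← adj_inner, ← og_inner V⁻¹, og_inv_apply]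
    simp_rw [← hc]
    exact uniformSphere_integral_comp W⁻¹ (fun x => h (adj ι x)) (hh.comp (adj ι).continuous)
  have hIntg : Integrable (Function.uncurry fun (V : OG s) (x : EE n) =>
      h (((V⁻¹ : OG s) : EE s →L[ℝ] EE s) (adj ι x))) ((hO s).prod (uniformSphere n)) := by
    refine integrable_of_sphere (C := L * 1) ?_ ?_
    · apply Continuous.aestronglyMeasurable
      exact hh.comp (cont_act continuous_fst ((adj ι).continuous.comp continuous_snd))
    · have : ∀ᵐ q ∂((hO s).prod (uniformSphere n)), ‖q.2‖ = 1 :=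
        Measure.quasiMeasurePreserving_snd.ae (uniformSphere_norm n)
      filter_upwards [this] with q hq
      refine (hhb _).trans ?_
      rw [og_norm]
      exact mul_le_mul_of_nonneg_left ((adj_norm ι _).trans hq.le) L.2
  calc _ = ∫ V, ∫ x, h (((V⁻¹ : OG s) : EE s →L[ℝ] EE s) (adj ι x))
        ∂(uniformSphere n) ∂(hO s) := by
        simp_rw [hV]; simp [h]
    _ = _ := by
        rw [integral_integral_swap hIntg]
        simp_rw [haar_avg hs hh hhb]
        rw [← integral_mul_const]
        congr 1
        ext x
        rw [← integral_const_mul]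
        congr 1
        ext y
        simp only [h, map_smul]
        rw [hf.hom _ _ (norm_nonneg _)]

lemma adj_mean_pos {n s : ℕ} (hn : 1 ≤ n) (hs : 1 ≤ s) (ι : EE s →ₗᵢ[ℝ] EE n) :
    0 < ∫ x, ‖adj ι x‖ ∂(uniformSphere n) := by
  have := uniformSphere_prob hn
  let e : EE s := EuclideanSpace.single ⟨0, hs⟩ 1
  have he : ‖e‖ = 1 := by simp [e]
  have h1 := sphere_second_moment hn (ι e)
  rw [ι.norm_map, he] at h1
  have hn0 : (0 : ℝ) < n := by exact_mod_cast hn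
  calc (0 : ℝ) < 1 ^ 2 / n := by positivity
    _ = _ := h1.symm
    _ ≤ _ := by
      refine integral_mono_ae ?_ ?_ ?_
      · refine integrable_of_sphere (C := 1) (by fun_prop) ?_
        filter_upwards [uniformSphere_norm n] with x hx
        have := abs_real_inner_le_norm (ι e) x
        rw [ι.norm_map, he, hx, mul_one] at this
        rw [abs_of_nonneg (sq_nonneg _)]
        exact (sq_le_one_iff_abs_le_one _).2 this
      · refine integrable_of_sphere (C := 1) (by fun_prop) ?_
        filter_upwards [uniformSphere_norm n] with x hx
        rw [abs_norm]
        exact (adj_norm ι x).trans hx.le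
      · filter_upwards [uniformSphere_norm n] with x hx
        have h2 : |inner ℝ (ι e) x| ≤ ‖adj ι x‖ := by
          rw [real_inner_comm, ← adj_inner]
          have := abs_real_inner_le_norm (adj ι x) e
          rwa [he, mul_one] at this
        have h3 : ‖adj ι x‖ ≤ 1 := (adj_norm ι x).trans hx.le
        rw [← sq_abs]
        nlinarith [abs_nonneg (inner ℝ (ι e) x)]

lemma exists_embed {n s : ℕ} (F : Submodule ℝ (EE n)) (h : Module.finrank ℝ F = s) :
    ∃ ι : EE s →ₗᵢ[ℝ] EE n, ∀ x, x ∈ F ↔ ∃ y, ι y = x := by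
  let v := (stdOrthonormalBasis ℝ F).reindex (finCongr h)
  refine ⟨F.subtypeₗᵢ.comp v.repr.symm.toLinearIsometry, fun x => ⟨fun hx => ?_, ?_⟩⟩
  · exact ⟨v.repr ⟨x, hx⟩, by simp⟩
  · rintro ⟨y, rfl⟩
    simp

lemma subsphere_iso {n s : ℕ} (F : Submodule ℝ (EE n)) (h : Module.finrank ℝ F = s)
    (ι : EE s →ₗᵢ[ℝ] EE n) (hι : ∀ y, ι y ∈ F) {f : EE n → ℝ} (hf : Continuous f) :
    subsphereAvg F f = ∫ θ, f (ι θ) ∂(uniformSphere s) := by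
  subst h
  let v := stdOrthonormalBasis ℝ F
  let j : EE (Module.finrank ℝ F) →ₗᵢ[ℝ] F :=
    { toLinearMap := LinearMap.codRestrict F ι.toLinearMap hι
      norm_map' := fun x => ι.norm_map x }
  obtain ⟨V, hV⟩ := og_of_isometry (v.repr.toLinearIsometry.comp j)
  rw [subsphereAvg, ← uniformSphere_integral_comp V]
  · congr 1
    ext θ
    rw [hV]
    simp [v]
    rfl
  · exact hf.comp (continuous_subtype_val.comp v.repr.symm.continuous)

/-- `P` is the projection `ι ι*`. -/
def RepP {n s : ℕ} (ι : EE s →ₗᵢ[ℝ] EE n) (P : Fin n → Fin n → ℝ) : Prop :=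
  ∀ x, Matrix.toEuclideanLin (Matrix.of P) x = ι (adj ι x)

lemma good_rep {n s : ℕ} (P : Fin n → Fin n → ℝ)
    (h1 : Matrix.of P * Matrix.of P = Matrix.of P) (h2 : (Matrix.of P)ᵀ = Matrix.of P)
    (h3 : (Matrix.of P).rank = s) :
    ∃ ι : EE s →ₗᵢ[ℝ] EE n, RepP ι P ∧ ∀ f : EE n → ℝ, Continuous f →
      subsphereAvg (LinearMap.range (Matrix.toEuclideanLin (Matrix.of P))) f
        = ∫ θ, f (ι θ) ∂(uniformSphere s) := by
  set p := Matrix.toEuclideanLin (Matrix.of P) with hp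
  have hsym : p.IsSymmetric := Matrix.isSymmetric_toEuclideanLin_iff.2 (by
    rw [Matrix.IsHermitian, Matrix.conjTranspose_eq_transpose_of_trivial, h2])
  have hid : ∀ x, p (p x) = p x := by
    intro x
    have : Matrix.toEuclideanLin (Matrix.of P * Matrix.of P) x = p x := by rw [h1]
    rw [Matrix.toLpLin_mul_same] at this
    exact this
  have hr : Module.finrank ℝ (LinearMap.range p) = s := by
    rw [← h3, Matrix.rank_eq_finrank_range_toLin _ (PiLp.basisFun 2 ℝ (Fin n))
      (PiLp.basisFun 2 ℝ (Fin n)), hp, Matrix.toEuclideanLin, Matrix.toLpLin_eq_toLin]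
  obtain ⟨ι, hι⟩ := exists_embed _ hr
  refine ⟨ι, fun x => ?_, fun f hf => subsphere_iso _ hr ι (fun y => (hι _).2 ⟨y, rfl⟩) hf⟩
  obtain ⟨y, hy⟩ := (hι (p x)).1 (LinearMap.mem_range_self p x)
  have h4 : adj ι x = adj ι (p x) := by
    refine ext_inner_right ℝ fun z => ?_
    rw [adj_inner, adj_inner]
    obtain ⟨w, hw⟩ := (hι (ι z)).2 ⟨z, rfl⟩
    rw [← hw, hsym, hid]
  change p x = _
  rw [h4, ← hy, adj_comp_self]

/-- matrix of the inverse of an element of the group -/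
noncomputable def mat {n : ℕ} (U : OG n) : Matrix (Fin n) (Fin n) ℝ :=
  (Matrix.toEuclideanCLM (n := Fin n) (𝕜 := ℝ)).symm ((U⁻¹ : OG n) : EE n →L[ℝ] EE n)

lemma symm_unitary {A B : Type*} [Ring A] [StarRing A] [Algebra ℝ A] [Ring B] [StarRing B]
    [Algebra ℝ B] (φ : A ≃⋆ₐ[ℝ] B) {u : B} (h : u ∈ unitary B) : φ.symm u ∈ unitary A := by
  rw [Unitary.mem_iff] at h ⊢
  rw [← map_star, ← map_mul, h.1, ← map_mul, h.2, map_one]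
  exact ⟨rfl, rfl⟩

lemma mat_mem {n : ℕ} (U : OG n) : mat U ∈ Matrix.orthogonalGroup (Fin n) ℝ :=
  symm_unitary (Matrix.toEuclideanCLM (n := Fin n) (𝕜 := ℝ)) (U⁻¹).2

lemma mat_cont {n : ℕ} : Continuous (mat : OG n → Matrix (Fin n) (Fin n) ℝ) := by
  have h : Continuous (Matrix.toEuclideanCLM (n := Fin n) (𝕜 := ℝ)).symm :=
    ((Matrix.toEuclideanCLM (n := Fin n) (𝕜 := ℝ)).symm.toAlgEquiv.toLinearMap).continuous_of_finiteDimensional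
  exact h.comp (continuous_subtype_val.comp continuous_inv)

lemma mat_apply {n : ℕ} (U : OG n) (x : EE n) :
    Matrix.toEuclideanLin (mat U) x = ((U⁻¹ : OG n) : EE n →L[ℝ] EE n) x := by
  rw [← Matrix.coe_toEuclideanCLM_eq_toEuclideanLin, mat]
  simp

lemma mat_transpose_apply {n : ℕ} (U : OG n) (x : EE n) :
    Matrix.toEuclideanLin (mat U)ᵀ x = (U : EE n →L[ℝ] EE n) x := by
  have h := (Matrix.mem_orthogonalGroup_iff (Fin n) ℝ).1 (mat_mem U)
  have h2 : Matrix.toEuclideanLin (mat U * (mat U)ᵀ) x = x := by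
    rw [h, Matrix.toLpLin_one]; rfl
  rw [Matrix.toLpLin_mul_same] at h2
  have h3 : ((U⁻¹ : OG n) : EE n →L[ℝ] EE n) (Matrix.toEuclideanLin (mat U)ᵀ x) = x := by
    rw [← mat_apply]; exact h2
  rw [← og_apply_inv U (Matrix.toEuclideanLin (mat U)ᵀ x), h3]

/-- conjugation -/
noncomputable def conjM {n : ℕ} (U : OG n) (P : Fin n → Fin n → ℝ) : Fin n → Fin n → ℝ :=
  Matrix.of.symm (mat U * Matrix.of P * (mat U)ᵀ)

lemma conjM_cont {n : ℕ} :
    Continuous (fun q : OG n × (Fin n → Fin n → ℝ) => conjM q.1 q.2) := by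
  have h1 : Continuous (fun q : OG n × (Fin n → Fin n → ℝ) => mat q.1) :=
    mat_cont.comp continuous_fst
  have h2 : Continuous (fun q : OG n × (Fin n → Fin n → ℝ) => Matrix.of q.2) :=
    continuous_snd
  exact ((h1.matrix_mul h2).matrix_mul h1.matrix_transpose)

/-- composition of an embedding with an inverse rotation -/
noncomputable def rotE {n s : ℕ} (U : OG n) (ι : EE s →ₗᵢ[ℝ] EE n) : EE s →ₗᵢ[ℝ] EE n :=
  (Unitary.linearIsometryEquiv (U⁻¹ : OG n)).toLinearIsometry.comp ι

lemma rotE_apply {n s : ℕ} (U : OG n) (ι : EE s →ₗᵢ[ℝ] EE n) (x : EE s) :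
    rotE U ι x = ((U⁻¹ : OG n) : EE n →L[ℝ] EE n) (ι x) := rfl

lemma rep_conj {n s : ℕ} {ι : EE s →ₗᵢ[ℝ] EE n} {P : Fin n → Fin n → ℝ} (h : RepP ι P) (U : OG n) :
    RepP (rotE U ι) (conjM U P) := by
  intro x
  have h1 : adj (rotE U ι) x = adj ι ((U : EE n →L[ℝ] EE n) x) := by
    refine ext_inner_right ℝ fun z => ?_
    rw [adj_inner, adj_inner, rotE_apply, ← og_inner U, og_apply_inv]
  rw [h1, rotE_apply, ← h, ← mat_apply, ← mat_transpose_apply, conjM, Equiv.apply_symm_apply,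
    Matrix.toLpLin_mul_same, Matrix.toLpLin_mul_same]
  rfl

/-- measurable version of the average -/
noncomputable def Xp {n : ℕ} (f : EE n → ℝ) (P : Fin n → Fin n → ℝ) : ℝ :=
  (∫ x, f (Matrix.toEuclideanLin (Matrix.of P) x) ∂(uniformSphere n)) /
    ∫ x, ‖Matrix.toEuclideanLin (Matrix.of P) x‖ ∂(uniformSphere n)

lemma Xp_meas {n : ℕ} (hn : 1 ≤ n) {f : EE n → ℝ} (hf : Continuous f) : Measurable (Xp f) := by
  have := uniformSphere_prob hn
  have hc : Continuous (fun q : (Fin n → Fin n → ℝ) × EE n =>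
      Matrix.toEuclideanLin (Matrix.of q.1) q.2) := by
    simp only [Matrix.toLpLin_apply]
    refine (PiLp.continuous_toLp 2 _).comp ?_
    refine continuous_pi fun i => ?_
    simp only [Matrix.mulVec, dotProduct, Matrix.of_apply]
    fun_prop
  exact (meas_int (F := fun (P : Fin n → Fin n → ℝ) (x : EE n) =>
      f (Matrix.toEuclideanLin (Matrix.of P) x)) (hf.comp hc)).div
    (meas_int (F := fun (P : Fin n → Fin n → ℝ) (x : EE n) =>
      ‖Matrix.toEuclideanLin (Matrix.of P) x‖) hc.norm)

lemma Xp_rep {n s : ℕ} (hn : 1 ≤ n) (hs : 1 ≤ s) {f : EE n → ℝ} {L : ℝ≥0} (hf : HomLip f L)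
    {ι : EE s →ₗᵢ[ℝ] EE n} {P : Fin n → Fin n → ℝ} (h : RepP ι P) :
    Xp f P = ∫ θ, f (ι θ) ∂(uniformSphere s) := by
  have h1 : ∀ x, Matrix.toEuclideanLin (Matrix.of P) x = ι (adj ι x) := h
  simp only [Xp, h1, ι.norm_map]
  rw [proj_avg hn hs hf, mul_div_cancel_left₀ _ (adj_mean_pos hn hs ι).ne']

lemma grass_mgf {n s : ℕ} (hn : 1 ≤ n) (hs : 1 ≤ s) {f : EE n → ℝ} {L : ℝ≥0} (hf : HomLip f L)
    {ν : Measure (Fin n → Fin n → ℝ)} (hν : IsHaarGrassmannian n s ν) (t : ℝ) :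
    ∫⁻ P, ENNReal.ofReal (exp (t * (Xp f P - ∫ θ, f θ ∂(uniformSphere n)))) ∂ν ≤
      ENNReal.ofReal (exp (π ^ 2 * L ^ 2 / (2 * c0 ^ 2 * n * s) * t ^ 2)) := by
  obtain ⟨hp, hgood, hinv⟩ := hν
  have := uniformSphere_prob hn
  have := uniformSphere_prob hs
  set M := ∫ θ, f θ ∂(uniformSphere n) with hM
  have hfi : Integrable f (uniformSphere n) := by
    refine integrable_of_sphere (C := L) hf.lip.continuous.aestronglyMeasurable ?_
    filter_upwards [uniformSphere_norm n] with x hx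
    have := hf.bound x
    rwa [hx, mul_one] at this
  have hni : ∫ x, ‖x‖ ∂(uniformSphere n) = 1 := by
    rw [integral_congr_ae (uniformSphere_norm n)]; simp
  have hnI : Integrable (fun x => ‖x‖) (uniformSphere n) := by
    refine integrable_of_sphere (C := 1) (by fun_prop) ?_
    filter_upwards [uniformSphere_norm n] with x hx
    simp [hx]
  have hML : |M| ≤ L := by
    have h := norm_integral_le_of_norm_le_const (μ := uniformSphere n) (f := f) (C := L) (by
      filter_upwards [uniformSphere_norm n] with x hx
      have := hf.bound x
      rwa [hx, mul_one] at this)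
    simpa using h
  let K : ℝ≥0 := ⟨|t|, abs_nonneg t⟩ * (2 * L)
  have hK : (K : ℝ) = |t| * (2 * L) := rfl
  have hg : HomLip (fun x => t * (f x - M * ‖x‖)) K := by
    refine ⟨LipschitzWith.of_dist_le_mul fun x y => ?_, fun c x hc => ?_⟩
    · have h1 := hf.lip.dist_le_mul x y
      rw [Real.dist_eq] at h1 ⊢
      have h2 : |‖x‖ - ‖y‖| ≤ dist x y := by rw [dist_eq_norm]; exact abs_norm_sub_norm_le x y
      have h3 : t * (f x - M * ‖x‖) - t * (f y - M * ‖y‖) =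
          t * ((f x - f y) - M * (‖x‖ - ‖y‖)) := by ring
      rw [h3, abs_mul, hK, mul_assoc]
      refine mul_le_mul_of_nonneg_left ?_ (abs_nonneg t)
      calc _ ≤ |f x - f y| + |M * (‖x‖ - ‖y‖)| := abs_sub _ _
        _ ≤ L * dist x y + L * dist x y := by
          rw [abs_mul]
          gcongr
        _ = _ := by ring
    · rw [hf.hom c x hc, norm_smul, Real.norm_eq_abs, abs_of_nonneg hc]; ring
  have hgm : ∫ θ, t * (f θ - M * ‖θ‖) ∂(uniformSphere n) = 0 := by
    rw [integral_const_mul, integral_sub hfi (hnI.const_mul _), integral_const_mul, hni, ← hM]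
    ring
  have hmF : Measurable fun P => ENNReal.ofReal (exp (t * (Xp f P - M))) :=
    ENNReal.measurable_ofReal.comp (measurable_exp.comp
      (((Xp_meas hn hf.lip.continuous).sub_const _).const_mul _))
  have hcU : ∀ U : OG n, Measurable (conjM U) := fun U =>
    (conjM_cont.comp (by fun_prop : Continuous fun P : Fin n → Fin n → ℝ => (U, P))).measurable
  calc _ = ∫⁻ U, ∫⁻ P, ENNReal.ofReal (exp (t * (Xp f P - M))) ∂ν ∂(hO n) := by simp
    _ = ∫⁻ U, ∫⁻ P, ENNReal.ofReal (exp (t * (Xp f (conjM U P) - M))) ∂ν ∂(hO n) := by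
        refine lintegral_congr fun U => ?_
        conv_lhs => rw [← hinv _ (mat_mem U)]
        exact lintegral_map hmF (hcU U)
    _ = ∫⁻ P, ∫⁻ U, ENNReal.ofReal (exp (t * (Xp f (conjM U P) - M))) ∂(hO n) ∂ν := by
        refine lintegral_lintegral_swap ?_
        exact (hmF.comp conjM_cont.measurable).aemeasurable
    _ ≤ ∫⁻ P, ENNReal.ofReal (exp (π ^ 2 * L ^ 2 / (2 * c0 ^ 2 * n * s) * t ^ 2)) ∂ν := by
        refine lintegral_mono_ae ?_
        filter_upwards [hgood] with P hP
        obtain ⟨ι, hr, -⟩ := good_rep P hP.1 hP.2.1 hP.2.2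
        have h1 : ∀ U : OG n, t * (Xp f (conjM U P) - M) =
            ∫ θ, t * (f (((U⁻¹ : OG n) : EE n →L[ℝ] EE n) (ι θ)) -
              M * ‖((U⁻¹ : OG n) : EE n →L[ℝ] EE n) (ι θ)‖) ∂(uniformSphere s) := by
          intro U
          rw [Xp_rep hn hs hf (rep_conj hr U)]
          simp only [og_norm, ι.norm_map, rotE_apply]
          rw [integral_const_mul, integral_sub, integral_const_mul,
            integral_congr_ae (uniformSphere_norm s)]
          · simp
          · refine sphere_int hs hf.lip.continuous hf.bound (B := 1) (rotE U ι).continuous L.2 ?_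
            intro θ hθ
            rw [og_norm, ι.norm_map, hθ]
          · refine integrable_of_sphere (C := |M|) (by fun_prop) ?_
            filter_upwards [uniformSphere_norm s] with x hx
            simp [hx]
        simp_rw [h1]
        refine (fixed_conc' hn hs ι hg hgm).trans (le_of_eq ?_)
        congr 2
        rw [hK, mul_pow, sq_abs]
        have := c0_pos.ne'
        have : (n : ℝ) ≠ 0 := by positivity
        have : (s : ℝ) ≠ 0 := by positivity
        field_simp
        ring
    _ = _ := by simp

lemma chernoff {α : Type*} [MeasurableSpace α] {μ : Measure α} {X : α → ℝ} (hX : Measurable X)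
    {K a : ℝ} (hK : 0 < K) (ha : 0 < a)
    (h : ∀ t : ℝ, ∫⁻ p, ENNReal.ofReal (exp (t * X p)) ∂μ ≤ ENNReal.ofReal (exp (K * t ^ 2))) :
    μ {p | a < |X p|} ≤ ENNReal.ofReal (2 * exp (-(a ^ 2 / (4 * K)))) := by
  have one : ∀ e : ℝ, e ^ 2 = 1 → μ {p | a ≤ e * X p} ≤ ENNReal.ofReal (exp (-(a ^ 2 / (4 * K)))) := by
    intro e he
    set t := a / (2 * K) with ht
    have ht0 : 0 < t := by positivity
    have hm : Measurable fun p => ENNReal.ofReal (exp (t * e * X p)) :=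
      ENNReal.measurable_ofReal.comp (measurable_exp.comp (hX.const_mul _))
    have h1 := mul_meas_ge_le_lintegral₀ (μ := μ) hm.aemeasurable (ENNReal.ofReal (exp (t * a)))
    have h2 : {p | a ≤ e * X p} ⊆
        {p | ENNReal.ofReal (exp (t * a)) ≤ ENNReal.ofReal (exp (t * e * X p))} := by
      intro p hp
      refine ENNReal.ofReal_le_ofReal (exp_le_exp.2 ?_)
      rw [mul_assoc]
      exact mul_le_mul_of_nonneg_left hp ht0.le
    have h3 := (mul_le_mul_right (measure_mono (μ := μ) h2) _).trans (h1.trans (h (t * e)))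
    have h4 : ENNReal.ofReal (exp (-(t * a))) * (ENNReal.ofReal (exp (t * a)) * μ {p | a ≤ e * X p}) =
        μ {p | a ≤ e * X p} := by
      rw [← mul_assoc, ← ENNReal.ofReal_mul (exp_nonneg _), ← exp_add]
      simp
    rw [← h4]
    refine (mul_le_mul_right h3 _).trans (le_of_eq ?_)
    rw [← ENNReal.ofReal_mul (exp_nonneg _), ← exp_add]
    congr 2
    rw [mul_pow, he, ht]
    field_simp
    ring
  have hsub : {p | a < |X p|} ⊆ {p | a ≤ 1 * X p} ∪ {p | a ≤ (-1) * X p} := by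
    intro p hp
    rcases lt_abs.1 (show a < |X p| from hp) with h | h
    · left; simpa using h.le
    · right; simpa using h.le
  refine (measure_mono hsub).trans ((measure_union_le _ _).trans ?_)
  rw [two_mul, ENNReal.ofReal_add (exp_nonneg _) (exp_nonneg _)]
  exact add_le_add (one 1 (by norm_num)) (one (-1) (by norm_num))

lemma gauge_homLip {n : ℕ} {A : Set (EE n)} (hA : Convex ℝ A) (hsym : A = -A)
    (hne : (interior A).Nonempty) :
    0 ≤ sphereMaxGauge A ∧ HomLip (gauge A) (sphereMaxGauge A).toNNReal := by
  have h0 : (0 : EE n) ∈ interior A := by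
    obtain ⟨x, hx⟩ := hne
    have hx' : -x ∈ interior A := by
      have h2 : interior A ⊆ (Homeomorph.neg (EE n)) ⁻¹' interior A := by
        rw [Homeomorph.preimage_interior]
        refine interior_mono fun y hy => ?_
        rw [hsym] at hy
        exact hy
      exact h2 hx
    have := hA.interior.midpoint_mem hx hx'
    simpa [midpoint_self_neg] using this
  have hnh : A ∈ 𝓝 (0 : EE n) := mem_interior_iff_mem_nhds.1 h0
  obtain ⟨r, hr, hball⟩ := Metric.mem_nhds_iff.1 hnh
  have habs : Absorbent ℝ A := absorbent_nhds_zero hnh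
  have hlip := hA.lipschitzWith_gauge (r := ⟨r, hr.le⟩) hr hball
  have hb0 : 0 ≤ sphereMaxGauge A := by
    refine Real.sSup_nonneg ?_
    rintro _ ⟨θ, -, rfl⟩
    exact gauge_nonneg θ
  have hbdd : BddAbove {r : ℝ | ∃ θ : EE n, ‖θ‖ = 1 ∧ r = gauge A θ} := by
    refine ⟨r⁻¹, ?_⟩
    rintro _ ⟨θ, hθ, rfl⟩
    have := hlip.dist_le_mul θ 0
    rw [dist_zero_right, hθ, Real.dist_eq, gauge_zero, sub_zero, mul_one,
      abs_of_nonneg (gauge_nonneg θ)] at this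
    exact this
  have hhom : ∀ (c : ℝ) (x : EE n), 0 ≤ c → gauge A (c • x) = c * gauge A x := by
    intro c x hc
    rw [gauge_smul_of_nonneg hc, smul_eq_mul]
  have hle : ∀ x : EE n, gauge A x ≤ sphereMaxGauge A * ‖x‖ := by
    intro x
    by_cases hx : x = 0
    · simp [hx]
    have hx0 : 0 < ‖x‖ := norm_pos_iff.2 hx
    have h1 : gauge A (‖x‖⁻¹ • x) ≤ sphereMaxGauge A :=
      le_csSup hbdd ⟨_, by rw [norm_smul, norm_inv, norm_norm, inv_mul_cancel₀ hx0.ne'], rfl⟩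
    rw [hhom _ _ (by positivity)] at h1
    rwa [inv_mul_le_iff₀' hx0] at h1
  refine ⟨hb0, ?_, hhom⟩
  refine LipschitzWith.of_le_add_mul _ fun x y => ?_
  have h1 := gauge_add_le hA habs y (x - y)
  rw [add_sub_cancel] at h1
  rw [Real.coe_toNNReal _ hb0, dist_eq_norm]
  exact h1.trans (by gcongr; exact hle _)

end Helpers

/-- Concentration for the map `F ↦ M_F(A) = ∫_{S_F} ‖θ‖_A dσ_F(θ)` on
the Grassmannian: `ν_{n,s}(|M_F(A) − M(A)| > ε M(A)) ≤ C exp(−c s ε² k(X))`. -/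
theorem concentration_M_grassmannian :
    ∃ C c : ℝ, 0 < C ∧ 0 < c ∧
      ∀ (n s : ℕ), 1 ≤ s → s ≤ n - 1 →
      ∀ A : Set (EuclideanSpace ℝ (Fin n)),
        IsCompact A → Convex ℝ A → A = -A → (interior A).Nonempty →
      ∀ ν : Measure (Fin n → Fin n → ℝ), IsHaarGrassmannian n s ν →
      ∀ ε : ℝ, 0 < ε →
        ν {P | ε * sphereMeanGauge A <
            |subsphereAvg (LinearMap.range (Matrix.toEuclideanLin (Matrix.of P))) (gauge A)
              - sphereMeanGauge A|}
          ≤ ENNReal.ofReal (C * Real.exp (-(c * s * ε ^ 2 * dvoretzkyDim A))) := by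
  have hc0 := c0_pos
  have hpi := Real.pi_pos
  refine ⟨2, c0 ^ 2 / (2 * π ^ 2), two_pos, by positivity, ?_⟩
  intro n s hs hsn A _ hA hsym hne ν hν ε hε
  have hn : 1 ≤ n := by omega
  obtain ⟨hb0, hf⟩ := gauge_homLip hA hsym hne
  have hp := hν.1
  have hM0 : 0 ≤ sphereMeanGauge A := integral_nonneg fun θ => gauge_nonneg θ
  by_cases hz : sphereMeanGauge A = 0 ∨ sphereMaxGauge A = 0
  · have hd : dvoretzkyDim A = 0 := by
      rcases hz with h | h <;> simp [dvoretzkyDim, h]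
    rw [hd]
    refine prob_le_one.trans ?_
    simp
  push Not at hz
  have hM : 0 < sphereMeanGauge A := lt_of_le_of_ne hM0 (Ne.symm hz.1)
  have hb : 0 < sphereMaxGauge A := lt_of_le_of_ne hb0 (Ne.symm hz.2)
  have hn0 : (0 : ℝ) < n := by exact_mod_cast hn
  have hs0 : (0 : ℝ) < s := by exact_mod_cast hs
  have hmgf := grass_mgf hn hs hf hν
  rw [Real.coe_toNNReal _ hb0] at hmgf
  have hch := chernoff (μ := ν) (X := fun P => Xp (gauge A) P - ∫ θ, gauge A θ ∂(uniformSphere n))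
    ((Xp_meas hn hf.lip.continuous).sub_const _)
    (K := π ^ 2 * sphereMaxGauge A ^ 2 / (2 * c0 ^ 2 * n * s)) (by positivity) (mul_pos hε hM) hmgf
  refine le_trans (measure_mono_ae ?_) (hch.trans (le_of_eq ?_))
  · filter_upwards [hν.2.1] with P hP
    obtain ⟨ι, hr, havg⟩ := good_rep P hP.1 hP.2.1 hP.2.2
    intro h
    change ε * sphereMeanGauge A < |Xp (gauge A) P - sphereMeanGauge A|
    rw [Xp_rep hn hs hf hr, ← havg _ hf.lip.continuous]
    exact h
  · congr 3
    rw [dvoretzkyDim, div_pow]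
    field_simp
    ring
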